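/- arXiv:1806.09676 — 10 statements merged into one kernel-verified Lean document; each statement's English description precedes it below -/
import Mathlib

section
/- Let (Y_n)_{n∈ℕ} be a sequence of nonempty finite sets and equip ∏_n Y_n with the product topology (each Y_n discrete). A set G ⊆ ∏_n Y_n is comeager if and only if there exist a partition of ℕ into pairwise disjoint finite intervals (E_i)_{i∈ℕ} covering ℕ and elements t_i ∈ ∏_{n∈E_i} Y_n such that every y ∈ ∏_n Y_n whose restriction to E_i equals t_i for infinitely many i belongs to G. -/
open PiNat in
theorem exists_cylinder_subset_of_isOpen {Y : ℕ → Type*} [∀ n, TopologicalSpace (Y n)]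
    [∀ n, DiscreteTopology (Y n)] {U : Set (∀ n, Y n)} (hU : IsOpen U) {x : ∀ n, Y n}
    (hx : x ∈ U) : ∃ n, cylinder x n ⊆ U := by
  obtain ⟨_, ⟨y, n, rfl⟩, hxy, hsub⟩ :=
    (isTopologicalBasis_cylinders Y).exists_subset_of_mem_open hx hU
  exact ⟨n, (mem_cylinder_iff_eq.1 hxy).trans_subset hsub⟩

/-- Replace the first `N` coordinates of `z` by `s`. -/
def replacePrefix {Y : ℕ → Type*} (N : ℕ) (s : ∀ i : Fin N, Y i) (z : ∀ n, Y n) : ∀ n, Y n :=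
  fun n => if h : n < N then s ⟨n, h⟩ else z n

theorem replacePrefix_of_lt {Y : ℕ → Type*} {N : ℕ} (s : ∀ i : Fin N, Y i) (z : ∀ n, Y n)
    {n : ℕ} (h : n < N) : replacePrefix N s z n = s ⟨n, h⟩ := dif_pos h

theorem replacePrefix_of_le {Y : ℕ → Type*} {N : ℕ} (s : ∀ i : Fin N, Y i) (z : ∀ n, Y n)
    {n : ℕ} (h : N ≤ n) : replacePrefix N s z n = z n := dif_neg h.not_gt

theorem continuous_replacePrefix {Y : ℕ → Type*} [∀ n, TopologicalSpace (Y n)] (N : ℕ)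
    (s : ∀ i : Fin N, Y i) : Continuous (replacePrefix N s) := by
  refine continuous_pi fun n => ?_
  rcases lt_or_ge n N with h | h
  · simp only [replacePrefix_of_lt s _ h, continuous_const]
  · simpa only [replacePrefix_of_le s _ h] using continuous_apply n

open PiNat in
theorem dense_preimage_replacePrefix {Y : ℕ → Type*} [∀ n, TopologicalSpace (Y n)]
    [∀ n, DiscreteTopology (Y n)] {V : Set (∀ n, Y n)} (hV : Dense V) (N : ℕ)
    (s : ∀ i : Fin N, Y i) : Dense (replacePrefix N s ⁻¹' V) := by
  refine dense_iff_inter_open.2 fun W hW ⟨z, hz⟩ => ?_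
  obtain ⟨K, hK⟩ := exists_cylinder_subset_of_isOpen hW hz
  obtain ⟨y, hy, hyV⟩ := hV.inter_open_nonempty _
    (isOpen_cylinder Y (replacePrefix N s z) (max N K)) ⟨_, self_mem_cylinder _ _⟩
  refine ⟨replacePrefix N (fun i => z i) y, hK fun n hn => ?_, ?_⟩
  · rcases lt_or_ge n N with h | h
    · rw [replacePrefix_of_lt _ _ h]
    · rw [replacePrefix_of_le _ _ h, hy n (hn.trans_le (le_max_right _ _)),
        replacePrefix_of_le _ _ h]
  · suffices h : replacePrefix N s (replacePrefix N (fun i => z i) y) = y by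
      rwa [Set.mem_preimage, h]
    funext n
    rcases lt_or_ge n N with h | h
    · rw [replacePrefix_of_lt _ _ h, hy n (h.trans_le (le_max_left _ _)),
        replacePrefix_of_lt _ _ h]
    · rw [replacePrefix_of_le _ _ h, replacePrefix_of_le _ _ h]

/-- Countably many dense open sets admit a single point `z` such that agreeing with `z` on a
sufficiently long interval forces membership. -/
theorem exists_forall_agree_on_Ico_imp_mem {Y : ℕ → Type*} [∀ n, Finite (Y n)]
    [∀ n, Nonempty (Y n)] [∀ n, TopologicalSpace (Y n)] [∀ n, DiscreteTopology (Y n)]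
    {V : ℕ → Set (∀ n, Y n)} (hVo : ∀ k, IsOpen (V k)) (hVd : ∀ k, Dense (V k)) :
    ∃ z : ∀ n, Y n, ∀ k N : ℕ, ∃ M, N < M ∧
      ∀ y : ∀ n, Y n, (∀ n ∈ Finset.Ico N M, y n = z n) → y ∈ V k := by
  have hd : Dense (⋂ p : Σ q : ℕ × ℕ, (∀ i : Fin q.2, Y i),
      replacePrefix p.1.2 p.2 ⁻¹' V p.1.1) :=
    dense_iInter_of_isOpen (fun p => (hVo _).preimage (continuous_replacePrefix _ _))
      fun p => dense_preimage_replacePrefix (hVd _) _ _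
  obtain ⟨z, hz⟩ := hd.nonempty
  refine ⟨z, fun k N => ?_⟩
  have hmem (s : ∀ i : Fin N, Y i) : replacePrefix N s z ∈ V k := Set.mem_iInter.1 hz ⟨(k, N), s⟩
  choose M hM using fun s => exists_cylinder_subset_of_isOpen (hVo k) (hmem s)
  obtain ⟨B, hB⟩ := (Set.finite_range M).bddAbove
  refine ⟨max (N + 1) B, by omega, fun y hy => hM (fun i => y i) fun n hn => ?_⟩
  rcases lt_or_ge n N with h | h
  · rw [replacePrefix_of_lt _ _ h]
  · rw [replacePrefix_of_le _ _ h]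
    exact hy n (Finset.mem_Ico.2
      ⟨h, (hn.trans_le (hB (Set.mem_range_self _))).trans_le (le_max_right _ _)⟩)

theorem setOf_infinite_agree_mem_residual {Y : ℕ → Type*} [∀ n, TopologicalSpace (Y n)]
    [∀ n, DiscreteTopology (Y n)] {E : ℕ → Finset ℕ} (t : ℕ → ∀ n, Y n)
    (hE : ∀ i j, i ≠ j → Disjoint (E i) (E j)) :
    {y : ∀ n, Y n | {i : ℕ | ∀ n ∈ E i, y n = t i n}.Infinite} ∈ residual (∀ n, Y n) := by
  have key (m : ℕ) : (⋃ i ∈ Set.Ici m, {y : ∀ n, Y n | ∀ n ∈ E i, y n = t i n}) ∈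
      residual (∀ n, Y n) := by
    refine residual_of_dense_open (isOpen_biUnion fun i _ => ?_)
      (dense_iff_inter_open.2 fun W hW ⟨z, hz⟩ => ?_)
    · simp only [Set.ofPred_forall]
      exact isOpen_biInter_finset fun n _ =>
        (isOpen_discrete {t i n}).preimage (continuous_apply n)
    · obtain ⟨N, hN⟩ := exists_cylinder_subset_of_isOpen hW hz
      have hfin : (⋃ n ∈ Set.Iio N, {i | n ∈ E i}).Finite :=
        (Set.finite_Iio N).biUnion fun n _ => Set.Subsingleton.finite fun i hi j hj => by
          by_contra hij
          exact Finset.disjoint_left.1 (hE i j hij) hi hj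
      obtain ⟨i, him, hi⟩ := ((Set.Ici_infinite m).sdiff hfin).nonempty
      refine ⟨replacePrefix N (fun j => z j) (t i),
        hN fun n hn => replacePrefix_of_lt _ _ hn,
        Set.mem_biUnion him fun n hn => replacePrefix_of_le _ _ ?_⟩
      by_contra! h
      exact hi (Set.mem_biUnion (Set.mem_Iio.2 h) hn)
  filter_upwards [countable_iInter_mem.2 key] with y hy
  refine Set.infinite_of_not_bddAbove fun ⟨b, hb⟩ => ?_
  obtain ⟨i, hi, hyi⟩ := Set.mem_iUnion₂.1 (Set.mem_iInter.1 hy (b + 1))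
  exact absurd (hb hyi) (Nat.not_le.2 hi)


/-- **Jalali-Naini–Talagrand characterization of comeager subsets of a product of finite
sets.**  Let `(Y n)` be nonempty finite sets, and give `∀ n, Y n` the product of the discrete
topologies.  A set `G` is comeager iff there is a partition of `ℕ` into pairwise disjoint
(nonempty) finite intervals `E i` covering `ℕ`, together with elements `t i` (recording values on
`E i`), such that every `y` that agrees with `t i` on `E i` for infinitely many `i` belongs
to `G`. -/
theorem talagrand_comeager_characterization
    (Y : ℕ → Type*) [∀ n, Fintype (Y n)] [∀ n, Nonempty (Y n)]
    [∀ n, TopologicalSpace (Y n)] [∀ n, DiscreteTopology (Y n)]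
    (G : Set (∀ n, Y n)) :
    G ∈ residual (∀ n, Y n) ↔
      ∃ (E : ℕ → Finset ℕ) (t : ℕ → ∀ n, Y n),
        (∀ i, ∃ a b : ℕ, a ≤ b ∧ E i = Finset.Icc a b) ∧
        (∀ i j, i ≠ j → Disjoint (E i) (E j)) ∧
        (∀ n : ℕ, ∃ i, n ∈ E i) ∧
        (∀ y : ∀ n, Y n, {i : ℕ | ∀ n ∈ E i, y n = t i n}.Infinite → y ∈ G) := by
  constructor
  · intro hG
    obtain ⟨D, hDG, hDδ, hDd⟩ := mem_residual.1 hG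
    obtain ⟨U, hUo, rfl⟩ := hDδ.eq_iInter_nat
    obtain ⟨z, hz⟩ := exists_forall_agree_on_Ico_imp_mem (V := fun k => ⋂ j ∈ Set.Iic k, U j)
      (fun k => (Set.finite_Iic k).isOpen_biInter fun j _ => hUo j)
      (fun k => hDd.mono (Set.subset_iInter₂ fun j _ => Set.iInter_subset U j))
    choose M hM hMV using hz
    let a : ℕ → ℕ := fun k => Nat.rec 0 (fun i N => M i N) k
    have ha : StrictMono a := strictMono_nat_of_lt_succ fun i => hM i (a i)
    have hmem (i n : ℕ) : n ∈ Finset.Icc (a i) (a (i + 1) - 1) ↔ a i ≤ n ∧ n < a (i + 1) := by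
      have : a i < a (i + 1) := ha i.lt_succ_self
      rw [Finset.mem_Icc]
      omega
    refine ⟨fun i => Finset.Icc (a i) (a (i + 1) - 1), fun _ => z,
      fun i => ⟨_, _, Nat.le_sub_one_of_lt (ha i.lt_succ_self), rfl⟩, fun i j hij => ?_,
      fun n => ?_, fun y hy => hDG (Set.mem_iInter.2 fun j => ?_)⟩
    · refine Finset.disjoint_left.2 fun n hi hj => hij ?_
      rw [hmem] at hi hj
      have h₁ := ha.lt_iff_lt (a := i) (b := j + 1) |>.1 (hi.1.trans_lt hj.2)
      have h₂ := ha.lt_iff_lt (a := j) (b := i + 1) |>.1 (hj.1.trans_lt hi.2)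
      omega
    · induction n with
      | zero => exact ⟨0, (hmem 0 0).2 ⟨le_rfl, ha Nat.zero_lt_one⟩⟩
      | succ n ih =>
        obtain ⟨i, hi⟩ := ih
        rw [hmem] at hi
        rcases lt_or_ge (n + 1) (a (i + 1)) with h | h
        · exact ⟨i, (hmem _ _).2 ⟨by omega, h⟩⟩
        · have : a (i + 1) < a (i + 1 + 1) := ha (i + 1).lt_succ_self
          exact ⟨i + 1, (hmem (i + 1) (n + 1)).2 ⟨h, by omega⟩⟩
    · obtain ⟨i, hi, hji⟩ := hy.exists_gt j
      have hyV := hMV i (a i) y fun n hn => hi n ((hmem i n).2 (Finset.mem_Ico.1 hn))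
      exact Set.mem_iInter₂.1 hyV j hji.le
  · rintro ⟨E, t, -, hE, -, hG⟩
    exact Filter.mem_of_superset (setOf_infinite_agree_mem_residual t hE) hG
end

section
/- Let J be a proper ideal on ℕ containing all finite subsets of ℕ. The following are equivalent: (1) J has the Baire property as a subset of P(ℕ); (2) J is meager; (3) there is a partition of ℕ into pairwise disjoint finite sets (E_n)_{n∈ℕ} such that for every infinite L ⊆ ℕ the set ⋃_{n∈L} E_n does not belong to J. -/
open scoped Classical in
/-- The characteristic function of a subset of `ℕ`, as a point of the Cantor space `ℕ → Bool`.
This identifies `𝒫(ℕ)` with the Cantor space `2^ℕ` carrying the product topology. -/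
noncomputable def charFun (S : Set ℕ) : ℕ → Bool := fun n => if n ∈ S then true else false

/-- A family of subsets of `ℕ` is meager if the corresponding subset of the Cantor space
`ℕ → Bool` is meager. -/
def MeagerFamily (J : Set (Set ℕ)) : Prop := IsMeagre (charFun '' J)

/-- A family of subsets of `ℕ` has the Baire property if the corresponding subset of the Cantor
space differs from an open set by a meager set. -/
def BairePropertyFamily (J : Set (Set ℕ)) : Prop :=
  ∃ U : Set (ℕ → Bool), IsOpen U ∧ IsMeagre (symmDiff (charFun '' J) U)

/-- An ideal on `ℕ`: a hereditary family of subsets of `ℕ` closed under finite unions. -/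
def IsSetIdeal (J : Set (Set ℕ)) : Prop :=
  (∀ A B : Set ℕ, A ⊆ B → B ∈ J → A ∈ J) ∧ (∀ A B : Set ℕ, A ∈ J → B ∈ J → A ∪ B ∈ J)

open Set Topology

theorem charFun_eq_true {S : Set ℕ} {n : ℕ} : charFun S n = true ↔ n ∈ S := by
  simp [charFun]

theorem charFun_setOf_eq_true (x : ℕ → Bool) : charFun {n | x n = true} = x := by
  ext n
  simp [charFun]

theorem mem_image_charFun {J : Set (Set ℕ)} {x : ℕ → Bool} :
    x ∈ charFun '' J ↔ {n | x n = true} ∈ J := by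
  constructor
  · rintro ⟨A, hA, rfl⟩
    simpa only [charFun_eq_true, ofPred_mem_eq] using hA
  · exact fun h => ⟨_, h, charFun_setOf_eq_true x⟩

theorem IsOpen.exists_cylinder_subset {U : Set (ℕ → Bool)} (hU : IsOpen U) {x : ℕ → Bool}
    (hx : x ∈ U) : ∃ m, PiNat.cylinder x m ⊆ U := by
  obtain ⟨_, ⟨y, m, rfl⟩, hxy, hsub⟩ :=
    (PiNat.isTopologicalBasis_cylinders (fun _ : ℕ => Bool)).exists_subset_of_mem_open hx hU
  exact ⟨m, (PiNat.mem_cylinder_iff_eq.1 hxy).symm ▸ hsub⟩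

/-- The self-homeomorphism of the Cantor space that flips the coordinates in `T`. -/
noncomputable def flipHomeomorph (T : Set ℕ) : (ℕ → Bool) ≃ₜ (ℕ → Bool) where
  toFun x n := xor (x n) (charFun T n)
  invFun x n := xor (x n) (charFun T n)
  left_inv x := by ext n; simp
  right_inv x := by ext n; simp
  continuous_toFun := continuous_pi fun n =>
    (continuous_of_discreteTopology (f := fun b => xor b (charFun T n))).comp (continuous_apply n)
  continuous_invFun := continuous_pi fun n =>
    (continuous_of_discreteTopology (f := fun b => xor b (charFun T n))).comp (continuous_apply n)

theorem flipHomeomorph_apply_of_mem {T : Set ℕ} {n : ℕ} (h : n ∈ T) (x : ℕ → Bool) :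
    flipHomeomorph T x n = !x n := by
  simp [flipHomeomorph, charFun, h]

theorem flipHomeomorph_apply_of_notMem {T : Set ℕ} {n : ℕ} (h : n ∉ T) (x : ℕ → Bool) :
    flipHomeomorph T x n = x n := by
  simp [flipHomeomorph, charFun, h]

theorem flipHomeomorph_flipHomeomorph (T : Set ℕ) (x : ℕ → Bool) :
    flipHomeomorph T (flipHomeomorph T x) = x :=
  (flipHomeomorph T).left_inv x

/-- A nonmeager family with the Baire property contains two sets whose union is cofinite. -/
theorem BairePropertyFamily.exists_cofinite_union {J : Set (Set ℕ)} (h : BairePropertyFamily J)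
    (hJ : ¬ MeagerFamily J) : ∃ A ∈ J, ∃ B ∈ J, (A ∪ B)ᶜ.Finite := by
  obtain ⟨U, hU, hUJ⟩ := h
  obtain ⟨x, hx⟩ : U.Nonempty := by
    by_contra hne
    rw [not_nonempty_iff_eq_empty] at hne
    subst hne
    exact hJ (hUJ.mono fun y hy => Or.inl ⟨hy, id⟩)
  obtain ⟨m, hm⟩ := hU.exists_cylinder_subset hx
  set C := PiNat.cylinder x m
  set σ := flipHomeomorph (Ici m)
  have hσC : ∀ y ∈ C, σ y ∈ C := fun y hy i hi => by
    rw [flipHomeomorph_apply_of_notMem (by simpa using hi)]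
    exact hy i hi
  have hmeagre : IsMeagre (C \ charFun '' J) :=
    hUJ.mono fun y hy => Or.inr ⟨hm hy.1, hy.2⟩
  have hnot := mt (hmeagre.union (hmeagre.preimage_of_isOpenMap σ.continuous σ.isOpenMap)).mono
    (not_isMeagre_of_isOpen (PiNat.isOpen_cylinder _ x m) ⟨x, PiNat.self_mem_cylinder x m⟩)
  obtain ⟨y, hyC, hy⟩ := not_subset.1 hnot
  have hyJ : y ∈ charFun '' J := by
    by_contra hn
    exact hy (Or.inl ⟨hyC, hn⟩)
  have hσyJ : σ y ∈ charFun '' J := by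
    by_contra hn
    exact hy (Or.inr ⟨hσC y hyC, hn⟩)
  refine ⟨_, mem_image_charFun.1 hyJ, _, mem_image_charFun.1 hσyJ,
    (finite_Iio m).subset fun i hi => ?_⟩
  by_contra him
  have := flipHomeomorph_apply_of_mem (show i ∈ Ici m by simpa using him) y
  simp_all [σ]

/-- Membership in a dense open subset of the Cantor space can be forced by finitely many
coordinates that all lie beyond a prescribed bound. -/
theorem exists_forcing_Ico {G : Set (ℕ → Bool)} (hG : IsOpen G) (hd : Dense G) (n : ℕ) :
    ∃ m, n < m ∧ ∃ s : ℕ → Bool, ∀ y : ℕ → Bool, (∀ i ∈ Finset.Ico n m, y i = s i) → y ∈ G := by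
  have hopen : ∀ T : Set (Fin n), IsOpen (flipHomeomorph (Fin.val '' T) ⁻¹' G) :=
    fun T => hG.preimage (Homeomorph.continuous _)
  obtain ⟨x, hx⟩ := (dense_iInter_of_isOpen hopen fun T =>
    hd.preimage (Homeomorph.isOpenMap _)).nonempty
  obtain ⟨m, hm⟩ := (isOpen_iInter_of_finite hopen).exists_cylinder_subset hx
  refine ⟨max m (n + 1), by simp, x, fun y hy => ?_⟩
  set T : Set (Fin n) := {i | y i ≠ x i}
  have hmem : flipHomeomorph (Fin.val '' T) y ∈ PiNat.cylinder x m := by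
    intro i hi
    by_cases hiT : i ∈ Fin.val '' T
    · rw [flipHomeomorph_apply_of_mem hiT]
      obtain ⟨j, hj, rfl⟩ := hiT
      exact (Bool.eq_not_of_ne (Ne.symm hj)).symm
    · rw [flipHomeomorph_apply_of_notMem hiT]
      by_cases hin : i < n
      · by_contra hne
        exact hiT ⟨⟨i, hin⟩, hne, rfl⟩
      · exact hy i (by simp; omega)
  have := mem_iInter.1 (hm hmem) T
  rwa [mem_preimage, flipHomeomorph_flipHomeomorph] at this

theorem MeagerFamily.exists_partition {J : Set (Set ℕ)} (h : MeagerFamily J)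
    (hJ : ∀ A B : Set ℕ, A ⊆ B → B ∈ J → A ∈ J) :
    ∃ E : ℕ → Finset ℕ,
      (∀ m n : ℕ, m ≠ n → Disjoint (E m) (E n)) ∧
      (∀ k : ℕ, ∃ n, k ∈ E n) ∧
      (∀ L : Set ℕ, L.Infinite → (⋃ n ∈ L, (E n : Set ℕ)) ∉ J) := by
  obtain ⟨t, ht, hGδ, hdense⟩ := mem_residual.1 h
  obtain ⟨f, hf, rfl⟩ := isGδ_iff_eq_iInter_nat.1 hGδ
  have hopen : ∀ k, IsOpen (⋂ i ∈ Iic k, f i) := fun k =>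
    (finite_Iic k).isOpen_biInter fun i _ => hf i
  have hd : ∀ k, Dense (⋂ i ∈ Iic k, f i) := fun k =>
    hdense.mono (subset_iInter₂ fun i _ => iInter_subset f i)
  choose g hg s hs using fun k => exists_forcing_Ico (hopen k) (hd k)
  let N : ℕ → ℕ := fun k => Nat.rec 0 (fun k n => g k n) k
  have hN : StrictMono N := strictMono_nat_of_lt_succ fun k => hg k (N k)
  refine ⟨fun k => Finset.Ico (N k) (N (k + 1)), fun m n hmn => ?_, fun k => ?_, fun L hL hLJ => ?_⟩
  · rw [← Finset.disjoint_coe, Finset.coe_Ico, Finset.coe_Ico]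
    exact hN.monotone.pairwise_disjoint_on_Ico_succ hmn
  · have hk : k ∈ ⋃ n, Ico (N n) (N (Order.succ n)) := by
      rw [iUnion_Ico_map_succ_eq_Ici (fun i => hN.monotone (Nat.zero_le i))
        hN.not_bddAbove_range_of_wellFoundedLT]
      exact Nat.zero_le k
    obtain ⟨n, hn⟩ := mem_iUnion.1 hk
    exact ⟨n, Finset.mem_Ico.2 hn⟩
  · let A : Set ℕ := {i | ∃ k ∈ L, i ∈ Finset.Ico (N k) (N (k + 1)) ∧ s k (N k) i = true}
    have hA : A ∈ J := hJ _ _ (fun i ⟨k, hk, hi, _⟩ => mem_biUnion hk hi) hLJ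
    refine ht (mem_iInter.2 fun i => ?_) ⟨A, hA, rfl⟩
    obtain ⟨k, hkL, hik⟩ := hL.exists_gt i
    refine mem_iInter₂.1 (hs k (N k) (charFun A) fun j hj => ?_) i hik.le
    rw [Bool.eq_iff_iff, charFun_eq_true]
    refine ⟨fun ⟨k', hk', hj', hsj⟩ => ?_, fun hsj => ⟨k, hkL, hj, hsj⟩⟩
    obtain rfl : k' = k := by
      by_contra hne
      exact disjoint_left.1 (hN.monotone.pairwise_disjoint_on_Ico_succ hne)
        (Finset.mem_Ico.1 hj') (Finset.mem_Ico.1 hj)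
    exact hsj

theorem meagerFamily_of_partition {J : Set (Set ℕ)} (hJ : ∀ A B : Set ℕ, A ⊆ B → B ∈ J → A ∈ J)
    {E : ℕ → Finset ℕ} (hdisj : ∀ m n : ℕ, m ≠ n → Disjoint (E m) (E n))
    (hE : ∀ L : Set ℕ, L.Infinite → (⋃ n ∈ L, (E n : Set ℕ)) ∉ J) : MeagerFamily J := by
  have hres : (⋂ k, ⋃ n ∈ Ici k, {x : ℕ → Bool | ∀ i ∈ E n, x i = true}) ∈
      residual (ℕ → Bool) := by
    refine countable_iInter_mem.2 fun k => residual_of_dense_open ?_ ?_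
    · refine isOpen_biUnion fun n _ => ?_
      simp only [ofPred_forall]
      exact isOpen_biInter_finset fun i _ =>
        (isOpen_discrete ({true} : Set Bool)).preimage
          (continuous_apply (A := fun _ : ℕ => Bool) i)
    · refine dense_iff_inter_open.2 fun U hU ⟨x, hx⟩ => ?_
      obtain ⟨m, hm⟩ := hU.exists_cylinder_subset hx
      have hfin : {n | ∃ i < m, i ∈ E n}.Finite := by
        have : {n | ∃ i < m, i ∈ E n} = ⋃ i ∈ Iio m, {n | i ∈ E n} := by ext; simp
        rw [this]
        refine (finite_Iio m).biUnion fun i _ => Set.Subsingleton.finite fun a ha b hb => ?_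
        by_contra hab
        exact Finset.disjoint_left.1 (hdisj a b hab) ha hb
      obtain ⟨n, hn, hkn⟩ := hfin.infinite_compl.exists_gt k
      refine ⟨fun i => if i ∈ E n then true else x i, hm fun i hi => ?_,
        mem_biUnion hkn.le fun i hi => if_pos hi⟩
      exact if_neg fun hin => hn ⟨i, hi, hin⟩
  refine Filter.mem_of_superset hres ?_
  rintro _ hx ⟨A, hA, rfl⟩
  refine hE {n | (E n : Set ℕ) ⊆ A} (infinite_of_forall_exists_gt fun k => ?_)
    (hJ _ _ (iUnion₂_subset fun n hn => hn) hA)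
  obtain ⟨n, hkn, hn⟩ := mem_iUnion₂.1 (mem_iInter.1 hx (k + 1))
  exact ⟨n, fun i hi => charFun_eq_true.1 (hn i hi), hkn⟩

/-- **Jalali-Naini–Talagrand.**  For a proper ideal `J` on `ℕ` containing all finite sets, the
following are equivalent: (1) `J` has the Baire property; (2) `J` is meager; (3) there is a
partition of `ℕ` into pairwise disjoint finite sets `E n` such that for every infinite `L ⊆ ℕ`
the union `⋃ n ∈ L, E n` is not in `J`. -/
theorem jalaliNaini_talagrand (J : Set (Set ℕ)) (hJ : IsSetIdeal J)
    (hproper : (Set.univ : Set ℕ) ∉ J) (hfin : ∀ S : Set ℕ, S.Finite → S ∈ J) :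
    (BairePropertyFamily J ↔ MeagerFamily J) ∧
    (MeagerFamily J ↔
      ∃ E : ℕ → Finset ℕ,
        (∀ m n : ℕ, m ≠ n → Disjoint (E m) (E n)) ∧
        (∀ k : ℕ, ∃ n, k ∈ E n) ∧
        (∀ L : Set ℕ, L.Infinite → (⋃ n ∈ L, (E n : Set ℕ)) ∉ J)) := by
  refine ⟨⟨fun h => ?_, fun h => ⟨∅, isOpen_empty, by
    rwa [← bot_eq_empty, symmDiff_bot]⟩⟩,
    fun h => h.exists_partition hJ.1, fun ⟨_, hdisj, _, hE⟩ =>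
      meagerFamily_of_partition hJ.1 hdisj hE⟩
  by_contra hm
  obtain ⟨A, hA, B, hB, hAB⟩ := h.exists_cofinite_union hm
  exact hproper (union_compl_self (A ∪ B) ▸ hJ.2 _ _ (hJ.2 _ _ hA hB) (hfin _ hAB))
end

section
/- If J is a meager ideal on ℕ, then there is a family F of infinite subsets of ℕ of cardinality 2^{ℵ₀} whose members have pairwise finite intersections and none of whose members belongs to J. Consequently, every ideal on ℕ which intersects every uncountable almost disjoint family of infinite subsets of ℕ (i.e., every ccc/Fin ideal) is a nonmeager subset of P(ℕ). -/
/-- An almost disjoint family: a family of infinite subsets of `ℕ` any two distinct members of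
which have finite intersection. -/
def IsAlmostDisjointFamily (F : Set (Set ℕ)) : Prop :=
  (∀ S ∈ F, S.Infinite) ∧ ∀ S ∈ F, ∀ T ∈ F, S ≠ T → (S ∩ T).Finite

/-- An ideal on `ℕ` is ccc/Fin if it meets every uncountable almost disjoint family of infinite
subsets of `ℕ`. -/
def IsCccFin (J : Set (Set ℕ)) : Prop :=
  ∀ F : Set (Set ℕ), ¬ F.Countable → IsAlmostDisjointFamily F → ∃ S ∈ F, S ∈ J

open Set in
/-- A dense open subset of the Cantor space is entered by fixing suitable coordinates in a block
`[a, b)`, for all of finitely many prescribed initial segments of length `a` at once. -/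
theorem exists_block_of_dense_open_of_finset {U : Set (ℕ → Bool)} (hU : IsOpen U) (hd : Dense U)
    (a : ℕ) (T : Finset (ℕ → Bool)) :
    ∃ b > a, ∃ s : ℕ → Bool, ∀ t ∈ T, ∀ y : ℕ → Bool,
      (∀ i < a, y i = t i) → (∀ i ∈ Ico a b, y i = s i) → y ∈ U := by
  classical
  induction T using Finset.induction_on with
  | empty => exact ⟨a + 1, by omega, fun _ => false, by simp⟩
  | insert t T _ ih =>
    obtain ⟨b, hb, s, hs⟩ := ih
    obtain ⟨w, hwz, hwU⟩ := hd.inter_open_nonempty _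
      (PiNat.isOpen_cylinder (fun _ => Bool) (fun i => if i < a then t i else s i) b)
      ⟨_, PiNat.self_mem_cylinder _ b⟩
    obtain ⟨_, ⟨v, c, rfl⟩, hwv, hvU⟩ :=
      (PiNat.isTopologicalBasis_cylinders (fun _ : ℕ => Bool)).exists_subset_of_mem_open hwU hU
    rw [PiNat.mem_cylinder_iff] at hwz hwv
    refine ⟨max b c, by omega, w, fun u hu y hyu hyw => ?_⟩
    obtain rfl | hu := Finset.mem_insert.1 hu
    · refine hvU (PiNat.mem_cylinder_iff.2 fun i hi => ?_)
      rw [← hwv i hi]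
      by_cases hia : i < a
      · rw [hyu i hia, hwz i (by omega), if_pos hia]
      · exact hyw i ⟨by omega, by omega⟩
    · refine hs u hu y hyu fun i hi => ?_
      rw [mem_Ico] at hi
      rw [hyw i ⟨hi.1, by omega⟩, hwz i hi.2, if_neg (by omega)]

open Set in
/-- A dense open subset of the Cantor space contains all points with a suitable restriction to
some block `[a, b)`, for every `a`. -/
theorem exists_block_of_dense_open {U : Set (ℕ → Bool)} (hU : IsOpen U) (hd : Dense U) (a : ℕ) :
    ∃ b > a, ∃ s : ℕ → Bool, ∀ y : ℕ → Bool, (∀ i ∈ Ico a b, y i = s i) → y ∈ U := by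
  classical
  obtain ⟨b, hb, s, hs⟩ := exists_block_of_dense_open_of_finset hU hd a
    ((Finset.univ : Finset (Fin a → Bool)).image fun t i => if h : i < a then t ⟨i, h⟩ else false)
  refine ⟨b, hb, s, fun y hy =>
    hs _ (Finset.mem_image_of_mem _ (Finset.mem_univ fun i : Fin a => y i)) y (fun i hi => ?_) hy⟩
  simp [hi]

open Set in
/-- Every meager subset `M` of the Cantor space admits an interval partition of `ℕ` and a pattern
on each interval such that no point of `M` matches infinitely many of the patterns. -/
theorem IsMeagre.exists_blocks {M : Set (ℕ → Bool)} (hM : IsMeagre M) :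
    ∃ (a : ℕ → ℕ) (x : ℕ → ℕ → Bool), StrictMono a ∧
      ∀ y, {n | ∀ i ∈ Ico (a n) (a (n + 1)), y i = x n i}.Infinite → y ∉ M := by
  obtain ⟨S, hSo, hSd, hSc, hSM⟩ := mem_residual_iff.1 hM
  obtain ⟨U, hU⟩ := (hSc.insert univ).exists_eq_range (insert_nonempty _ _)
  have hUo (n) : IsOpen (U n) := by
    obtain h | h := hU ▸ mem_range_self (f := U) n
    · exact h ▸ isOpen_univ
    · exact hSo _ h
  have hUd (n) : Dense (U n) := by
    obtain h | h := hU ▸ mem_range_self (f := U) n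
    · exact h ▸ dense_univ
    · exact hSd _ h
  have hVo (n : ℕ) : IsOpen (⋂ k ∈ Iic n, U k) :=
    (finite_Iic n).isOpen_biInter fun k _ => hUo k
  have hVd (n : ℕ) : Dense (⋂ k ∈ Iic n, U k) :=
    dense_biInter_of_isOpen (fun k _ => hUo k) (finite_Iic n).countable fun k _ => hUd k
  choose b hb s hs using fun n => exists_block_of_dense_open (hVo n) (hVd n)
  let a : ℕ → ℕ := Nat.rec 0 b
  refine ⟨a, fun n => s n (a n), strictMono_nat_of_lt_succ fun n => hb n (a n),
    fun y hy hyM => hSM (mem_sInter.2 fun t ht => ?_) hyM⟩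
  obtain ⟨k, rfl⟩ : t ∈ range U := hU ▸ mem_insert_of_mem _ ht
  obtain ⟨n, hn, hkn⟩ := hy.exists_gt k
  exact mem_iInter₂.1 (hs n (a n) y hn) k hkn.le

open Set in
/-- There is an almost disjoint family of infinite subsets of `ℕ` indexed by the Cantor space. -/
theorem exists_almostDisjoint_cantor :
    ∃ B : (ℕ → Bool) → Set ℕ, (∀ f, (B f).Infinite) ∧ ∀ f g, f ≠ g → (B f ∩ B g).Finite := by
  have hinj (f : ℕ → Bool) :
      Function.Injective fun n => Encodable.encode ((List.range n).map f) := fun m n h => by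
    simpa using congrArg List.length (Encodable.encode_injective h)
  refine ⟨fun f => range fun n => Encodable.encode ((List.range n).map f),
    fun f => infinite_range_of_injective (hinj f), fun f g hfg => ?_⟩
  obtain ⟨k, hk⟩ := Function.ne_iff.1 hfg
  refine ((finite_Iic k).image fun n => Encodable.encode ((List.range n).map f)).subset ?_
  rintro _ ⟨⟨m, rfl⟩, n, h⟩
  have h := Encodable.encode_injective h
  obtain rfl : n = m := by simpa using congrArg List.length h
  refine ⟨n, ?_, rfl⟩
  by_contra hkn
  rw [mem_Iic, not_le] at hkn
  exact hk (List.map_inj_left.1 h k (List.mem_range.2 hkn)).symm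

theorem StrictMono.eq_of_mem_Ico_of_mem_Ico {a : ℕ → ℕ} (ha : StrictMono a) {m n i : ℕ}
    (hm : i ∈ Set.Ico (a m) (a (m + 1))) (hn : i ∈ Set.Ico (a n) (a (n + 1))) : m = n := by
  have h₁ := ha.lt_iff_lt.1 (hm.1.trans_lt hn.2)
  have h₂ := ha.lt_iff_lt.1 (hn.1.trans_lt hm.2)
  omega

open Set in
theorem exists_almostDisjoint_of_meagerFamily {J : Set (Set ℕ)}
    (hJ : ∀ A B : Set ℕ, A ⊆ B → B ∈ J → A ∈ J) (hM : MeagerFamily J) :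
    ∃ F : Set (Set ℕ), Cardinal.mk F = Cardinal.continuum ∧
      IsAlmostDisjointFamily F ∧ ∀ S ∈ F, S ∉ J := by
  obtain ⟨a, x, ha, hx⟩ := IsMeagre.exists_blocks hM
  obtain ⟨B, hBinf, hBfin⟩ := exists_almostDisjoint_cantor
  let A (f : ℕ → Bool) : Set ℕ := ⋃ n ∈ B f, Ico (a n) (a (n + 1))
  have hAinf (f) : (A f).Infinite := by
    refine ((hBinf f).image ha.injective.injOn).mono ?_
    rintro _ ⟨n, hn, rfl⟩
    exact mem_biUnion hn ⟨le_rfl, ha n.lt_succ_self⟩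
  have hAfin (f g) (hfg : f ≠ g) : (A f ∩ A g).Finite := by
    refine ((hBfin f g hfg).biUnion fun n _ => finite_Ico (a n) (a (n + 1))).subset ?_
    rintro i ⟨hf, hg⟩
    obtain ⟨m, hm, him⟩ := mem_iUnion₂.1 hf
    obtain ⟨n, hn, hin⟩ := mem_iUnion₂.1 hg
    obtain rfl := ha.eq_of_mem_Ico_of_mem_Ico him hin
    exact mem_biUnion ⟨hm, hn⟩ him
  have hAinj : Function.Injective A := fun f g h => by
    by_contra hfg
    exact hAinf f (by simpa [h] using hAfin f g hfg)
  refine ⟨range A, by simp [Cardinal.mk_range_eq A hAinj], ⟨?_, ?_⟩, ?_⟩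
  · rintro _ ⟨f, rfl⟩
    exact hAinf f
  · rintro _ ⟨f, rfl⟩ _ ⟨g, rfl⟩ h
    exact hAfin f g fun hfg => h (hfg ▸ rfl)
  · rintro _ ⟨f, rfl⟩ hfJ
    let Y : Set ℕ := {i | ∃ n ∈ B f, i ∈ Ico (a n) (a (n + 1)) ∧ x n i = true}
    have hYA : Y ⊆ A f := fun i ⟨n, hn, hi, _⟩ => mem_biUnion hn hi
    refine hx (charFun Y) ((hBinf f).mono fun n hn i hi => ?_) ⟨Y, hJ _ _ hYA hfJ, rfl⟩
    have hiY : i ∈ Y ↔ x n i = true := by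
      refine ⟨fun ⟨m, _, hmi, h⟩ => ?_, fun h => ⟨n, hn, hi, h⟩⟩
      rwa [ha.eq_of_mem_Ico_of_mem_Ico hi hmi]
    cases h : x n i <;> simp [charFun, hiY, h]

/-- If `J` is a meager ideal on `ℕ`, then there is an almost disjoint family of size continuum
disjoint from `J`; consequently every ccc/Fin ideal is nonmeager. -/
theorem meager_ideal_admits_large_ad_family_and_cccFin_nonmeager :
    (∀ J : Set (Set ℕ), IsSetIdeal J → MeagerFamily J →
      ∃ F : Set (Set ℕ), Cardinal.mk F = Cardinal.continuum ∧
        IsAlmostDisjointFamily F ∧ ∀ S ∈ F, S ∉ J) ∧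
    (∀ J : Set (Set ℕ), IsSetIdeal J → IsCccFin J → ¬ MeagerFamily J) := by
  refine ⟨fun J hJ hM => exists_almostDisjoint_of_meagerFamily hJ.1 hM, fun J hJ hccc hM => ?_⟩
  obtain ⟨F, hF, hAD, hFJ⟩ := exists_almostDisjoint_of_meagerFamily hJ.1 hM
  have hFc : ¬ F.Countable := fun hc =>
    (Cardinal.aleph0_lt_continuum.trans_eq hF.symm).not_ge
      (Cardinal.le_aleph0_iff_set_countable.2 hc)
  obtain ⟨S, hSF, hSJ⟩ := hccc F hFc hAD
  exact hFJ S hSF hSJ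
end

section
/- If H and K are hereditary, everywhere nonmeager subsets of P(ℕ), then H ∩ K is hereditary and everywhere nonmeager. -/
/-- A hereditary family of subsets of `ℕ`. -/
def Hereditary (H : Set (Set ℕ)) : Prop := ∀ A B : Set ℕ, A ⊆ B → B ∈ H → A ∈ H

/-- A family of subsets of `ℕ` is everywhere nonmeager if its intersection with every nonempty
open subset of the Cantor space is nonmeager. -/
def EverywhereNonmeagerFamily (H : Set (Set ℕ)) : Prop :=
  ∀ U : Set (ℕ → Bool), IsOpen U → U.Nonempty → ¬ IsMeagre (charFun '' H ∩ U)

open Topology TopologicalSpace Filter Set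

section KuratowskiUlam

variable {X Y : Type*} [TopologicalSpace X] [TopologicalSpace Y] [SecondCountableTopology Y]

/-- Almost every vertical section of a dense open set is residual. -/
theorem IsOpen.eventually_residual_section {D : Set (X × Y)} (ho : IsOpen D) (hd : Dense D) :
    ∀ᶠ x in residual X, Prod.mk x ⁻¹' D ∈ residual Y := by
  have hb := isBasis_countableBasis Y
  have key : ∀ V ∈ countableBasis Y,
      ∀ᶠ x in residual X, (V ∩ Prod.mk x ⁻¹' D).Nonempty := by
    intro V hV
    have hVo : IsOpen V := hb.isOpen hV
    have hVne : V.Nonempty := nonempty_of_mem_countableBasis hV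
    have hproj : IsOpen (Prod.fst '' (D ∩ univ ×ˢ V)) :=
      isOpenMap_fst _ (ho.inter (isOpen_univ.prod hVo))
    refine mem_of_superset (residual_of_dense_open hproj ?_) ?_
    · refine dense_iff_inter_open.2 fun W hW hWne => ?_
      obtain ⟨⟨x, y⟩, ⟨hx, hy⟩, hxy⟩ :=
        dense_iff_inter_open.1 hd (W ×ˢ V) (hW.prod hVo) (hWne.prod hVne)
      exact ⟨x, hx, (x, y), ⟨hxy, trivial, hy⟩, rfl⟩
    · rintro _ ⟨⟨x, y⟩, ⟨hxy, -, hy⟩, rfl⟩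
      exact ⟨y, hy, hxy⟩
  filter_upwards [(eventually_countable_ball (countable_countableBasis Y)).2 key] with x hx
  exact residual_of_dense_open (ho.preimage (Continuous.prodMk_right x))
    (hb.dense_iff.2 fun V hV _ => hx V hV)

/-- One half of the Kuratowski–Ulam theorem: almost every vertical section of a residual subset
of a product is residual. -/
theorem eventually_residual_section_of_mem_residual {R : Set (X × Y)}
    (hR : R ∈ residual (X × Y)) :
    ∀ᶠ x in residual X, Prod.mk x ⁻¹' R ∈ residual Y := by
  obtain ⟨S, hSo, hSd, hSc, hSR⟩ := mem_residual_iff.1 hR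
  have hS : ∀ᶠ x in residual X, ∀ D ∈ S, Prod.mk x ⁻¹' D ∈ residual Y :=
    (eventually_countable_ball hSc).2 fun D hD =>
      (hSo D hD).eventually_residual_section (hSd D hD)
  filter_upwards [hS] with x hx
  refine mem_of_superset ((countable_bInter_mem hSc).2 hx) fun y hy => hSR fun D hD => ?_
  exact mem_iInter₂.1 hy D hD

end KuratowskiUlam

/-- A nonmeager set meets every residual set. -/
theorem exists_mem_of_not_isMeagre_of_residual {X : Type*} [TopologicalSpace X] {s r : Set X}
    (hs : ¬ IsMeagre s) (hr : r ∈ residual X) : ∃ x ∈ s, x ∈ r := by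
  by_contra! h
  exact hs (mem_of_superset hr fun x hxr hxs => h x hxs hxr)

theorem continuous_cantor_inf :
    Continuous fun p : (ℕ → Bool) × (ℕ → Bool) => p.1 ⊓ p.2 := by
  have h : Continuous fun t : Bool × Bool => t.1 ⊓ t.2 := continuous_of_discreteTopology
  exact continuous_pi fun i => h.comp
    (f := fun p : (ℕ → Bool) × (ℕ → Bool) => (p.1 i, p.2 i)) (by fun_prop)

/-- Intersection of sets, seen on the Cantor space, is an open map. -/
theorem isOpenMap_cantor_inf :
    IsOpenMap fun p : (ℕ → Bool) × (ℕ → Bool) => p.1 ⊓ p.2 := by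
  refine IsOpenMap.of_sections fun ⟨a, b⟩ => ?_
  refine ⟨fun c => (fun i => if c i = (a i ⊓ b i) then a i else c i,
    fun i => if c i = (a i ⊓ b i) then b i else c i), ?_, ?_, ?_⟩
  · refine Continuous.continuousAt (.prodMk ?_ ?_) <;> refine continuous_pi fun i => ?_
    · exact (continuous_of_discreteTopology
        (f := fun t : Bool => if t = (a i ⊓ b i) then a i else t)).comp (continuous_apply i)
    · exact (continuous_of_discreteTopology
        (f := fun t : Bool => if t = (a i ⊓ b i) then b i else t)).comp (continuous_apply i)
  · simp
  · intro c
    funext i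
    change (if c i = (a i ⊓ b i) then a i else c i) ⊓ (if c i = (a i ⊓ b i) then b i else c i) = c i
    split_ifs with h
    · exact h.symm
    · exact inf_idem _

theorem charFun_inter (A B : Set ℕ) : charFun (A ∩ B) = charFun A ⊓ charFun B := by
  funext i
  by_cases hA : i ∈ A <;> by_cases hB : i ∈ B <;> simp [charFun, hA, hB]

/-- Every nonempty open subset of the Cantor space contains a nonempty open set closed under
intersections. -/
theorem exists_isOpen_infClosed_subset {U : Set (ℕ → Bool)} (hU : IsOpen U) (hne : U.Nonempty) :
    ∃ V ⊆ U, IsOpen V ∧ V.Nonempty ∧ InfClosed V := by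
  obtain ⟨x, hx⟩ := hne
  obtain ⟨I, u, hu, hIU⟩ := isOpen_pi_iff.1 hU x hx
  refine ⟨(I : Set ℕ).pi fun i => {x i}, fun y hy => hIU fun i hi => ?_,
    isOpen_set_pi I.finite_toSet fun i _ => isOpen_discrete _, ⟨x, fun i _ => rfl⟩, ?_⟩
  · rw [show y i = x i from hy i hi]
    exact (hu i hi).2
  · intro y hy z hz i hi
    have hyi : y i = x i := hy i hi
    have hzi : z i = x i := hz i hi
    simp [hyi, hzi]

/-- The intersection of two hereditary everywhere nonmeager families is hereditary and
everywhere nonmeager. -/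
theorem inter_hereditary_everywhereNonmeager (H K : Set (Set ℕ))
    (hherH : Hereditary H) (hherK : Hereditary K)
    (hH : EverywhereNonmeagerFamily H) (hK : EverywhereNonmeagerFamily K) :
    Hereditary (H ∩ K) ∧ EverywhereNonmeagerFamily (H ∩ K) := by
  refine ⟨fun A B hAB hB => ⟨hherH A B hAB hB.1, hherK A B hAB hB.2⟩, fun U hU hne hmeagre => ?_⟩
  obtain ⟨V, hVU, hV, hVne, hVinf⟩ := exists_isOpen_infClosed_subset hU hne
  have hR : (charFun '' (H ∩ K) ∩ U)ᶜ ∈ residual (ℕ → Bool) := hmeagre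
  have hsec := eventually_residual_section_of_mem_residual
    (tendsto_residual_of_isOpenMap continuous_cantor_inf isOpenMap_cantor_inf hR)
  obtain ⟨_, ⟨⟨A, hA, rfl⟩, hAV⟩, hAsec⟩ :=
    exists_mem_of_not_isMeagre_of_residual (hH V hV hVne) hsec
  obtain ⟨_, ⟨⟨B, hB, rfl⟩, hBV⟩, hBR⟩ :=
    exists_mem_of_not_isMeagre_of_residual (hK V hV hVne) hAsec
  refine hBR ⟨⟨A ∩ B, ⟨hherH _ A inter_subset_left hA, hherK _ B inter_subset_right hB⟩,
    charFun_inter A B⟩, hVU (hVinf hAV hBV)⟩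
end

section
/- Let (Y_n)_{n∈ℕ} be nonempty finite sets, each with a distinguished element 0_n, equip ∏_n Y_n with the product topology, and let J be a nonmeager ideal on ℕ. Then the set {x ∈ ∏_n Y_n : {n ∈ ℕ : x_n ≠ 0_n} ∈ J} is a nonmeager subset of ∏_n Y_n. -/
open Filter Topology TopologicalSpace Set

/-- The Kuratowski–Ulam theorem for a dense open set: almost all of its sections are residual. -/
theorem IsOpen.eventually_residual_section_s6 {X Z : Type*} [TopologicalSpace X] [TopologicalSpace Z]
    [SecondCountableTopology Z] {U : Set (X × Z)} (hU : IsOpen U) (hd : Dense U) :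
    ∀ᶠ x in residual X, ∀ᶠ z in residual Z, (x, z) ∈ U := by
  have hbasis : ∀ V ∈ countableBasis Z, ∀ᶠ x in residual X, ∃ z ∈ V, (x, z) ∈ U := by
    intro V hV
    have hVo : IsOpen V := isOpen_of_mem_countableBasis hV
    have himage : {x | ∃ z ∈ V, (x, z) ∈ U} = Prod.fst '' (U ∩ univ ×ˢ V) := by
      ext x
      simp [and_comm]
    refine residual_of_dense_open ?_ ?_
    · rw [himage]
      exact isOpenMap_fst _ (hU.inter (isOpen_univ.prod hVo))
    · refine dense_iff_inter_open.2 fun W hW hWne => ?_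
      obtain ⟨⟨x, z⟩, ⟨hx, hz⟩, hxz⟩ := hd.inter_open_nonempty (W ×ˢ V) (hW.prod hVo)
        (hWne.prod (nonempty_of_mem_countableBasis hV))
      exact ⟨x, hx, z, hz, hxz⟩
  filter_upwards [(eventually_countable_ball (countable_countableBasis Z)).2 hbasis] with x hx
  refine residual_of_dense_open (hU.preimage (by fun_prop : Continuous fun z => (x, z))) ?_
  refine (isBasis_countableBasis Z).dense_iff.2 fun V hV _ => ?_
  exact hx V hV

/-- One direction of the Kuratowski–Ulam theorem: if a property holds almost everywhere on a
product in the sense of category, then it holds almost everywhere on almost all sections. -/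
theorem Filter.Eventually.residual_section {X Z : Type*} [TopologicalSpace X] [TopologicalSpace Z]
    [SecondCountableTopology Z] {p : X × Z → Prop} (h : ∀ᶠ q in residual (X × Z), p q) :
    ∀ᶠ x in residual X, ∀ᶠ z in residual Z, p (x, z) := by
  obtain ⟨S, ho, hd, hc, hS⟩ := mem_residual_iff.1 h
  filter_upwards [(eventually_countable_ball hc).2
    fun U hU => (ho U hU).eventually_residual_section_s6 (hd U hU)] with x hx
  filter_upwards [(eventually_countable_ball hc).2 hx] with z hz
  exact hS hz

/-- Replace by `y₀ n` every coordinate of a point at which the given 0-1 sequence vanishes. -/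
def maskCoordinates {ι : Type*} {Y : ι → Type*} (y₀ : ∀ n, Y n) (q : (ι → Bool) × (∀ n, Y n)) :
    ∀ n, Y n :=
  fun n => if q.1 n then q.2 n else y₀ n

theorem isOpenQuotientMap_maskCoordinates {ι : Type*} {Y : ι → Type*}
    [∀ n, TopologicalSpace (Y n)] [∀ n, DiscreteTopology (Y n)] (y₀ : ∀ n, Y n) :
    IsOpenQuotientMap (maskCoordinates y₀) := by
  have hcoord : ∀ n, IsOpenQuotientMap fun p : Bool × Y n => if p.1 then p.2 else y₀ n :=
    fun n => ⟨fun y => ⟨(true, y), rfl⟩, continuous_of_discreteTopology,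
      fun _ _ => isOpen_discrete _⟩
  let e : (ι → Bool) × (∀ n, Y n) ≃ₜ ∀ n, Bool × Y n :=
    { (Equiv.arrowProdEquivProdArrow ι (fun _ => Bool) Y).symm with
      continuous_toFun := continuous_pi fun n =>
        ((continuous_apply n).comp continuous_fst).prodMk
          ((continuous_apply n).comp continuous_snd)
      continuous_invFun :=
        (continuous_pi fun n => continuous_fst.comp (continuous_apply n)).prodMk
          (continuous_pi fun n => continuous_snd.comp (continuous_apply n)) }
  exact (IsOpenQuotientMap.piMap hcoord).comp e.isOpenQuotientMap

/-- Let `(Y n)` be nonempty finite sets with distinguished points `y₀ n`, and let `J` be a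
nonmeager ideal on `ℕ`.  Then the set of points of `∀ n, Y n` whose support (set of coordinates
where they differ from `y₀`) lies in `J` is a nonmeager subset of the product. -/
theorem support_in_nonmeager_ideal_nonmeager
    (Y : ℕ → Type*) [∀ n, Fintype (Y n)] [∀ n, Nonempty (Y n)]
    [∀ n, TopologicalSpace (Y n)] [∀ n, DiscreteTopology (Y n)]
    (y₀ : ∀ n, Y n)
    (J : Set (Set ℕ)) (hJ : IsSetIdeal J) (hnm : ¬ MeagerFamily J) :
    ¬ IsMeagre {x : ∀ n, Y n | {n : ℕ | x n ≠ y₀ n} ∈ J} := by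
  intro hM
  apply hnm
  have hmask := isOpenQuotientMap_maskCoordinates y₀
  have hsection := Filter.Eventually.residual_section
    (hM.preimage_of_isOpenMap hmask.continuous hmask.isOpenMap)
  refine mem_of_superset hsection ?_
  rintro b hb ⟨A, hA, rfl⟩
  obtain ⟨x, hx⟩ := (dense_of_mem_residual hb).nonempty
  refine hx (hJ.1 _ A (fun n hn => ?_) hA)
  by_contra hnA
  exact hn (by simp [maskCoordinates, charFun, hnA])
end

section
/- Let J be a nonmeager ideal on ℕ and suppose J = ⋃_{n∈ℕ} H_n, where each H_n ⊆ P(ℕ) is hereditary. Then every S ∈ J belongs to some H_n which is nonmeager; that is, J equals the union of those H_n which are nonmeager. -/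
/-- If a nonmeager ideal `J` on `ℕ` is the union of a sequence of hereditary families `H n`,
then every `S ∈ J` belongs to some nonmeager `H n`; i.e. `J` is the union of those `H n` which
are nonmeager. -/
theorem nonmeager_ideal_union_hereditary (J : Set (Set ℕ)) (H : ℕ → Set (Set ℕ))
    (hJ : IsSetIdeal J) (hnm : ¬ MeagerFamily J)
    (hher : ∀ n, Hereditary (H n)) (hcover : J = ⋃ n, H n) :
    ∀ S ∈ J, ∃ n, S ∈ H n ∧ ¬ MeagerFamily (H n) := by
  intro S hS
  by_contra! h
  refine hnm (IsMeagre.mono (s := ⋃ n, ⋃ _ : S ∈ H n, charFun '' H n) ?_ ?_)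
  · rintro _ ⟨A, hA, rfl⟩
    obtain ⟨n, hn⟩ := Set.mem_iUnion.1 (hcover ▸ hJ.2 A S hA hS)
    exact Set.mem_iUnion₂.2 ⟨n, hher n _ _ Set.subset_union_right hn,
      A, hher n _ _ Set.subset_union_left hn, rfl⟩
  · refine isMeagre_iUnion fun n => ?_
    by_cases hn : S ∈ H n
    · simpa [hn, MeagerFamily] using h n hn
    · simp [hn, IsMeagre.empty]
end

section
/- Let A be a C*-algebra with an approximate identity (e_n) as described, let (E_m)_{m∈ℕ} be a sequence of finite-dimensional complex Banach spaces, let α : ∏_m E_m → 𝓜(A) be asymptotically additive, and let q ∈ 𝓜(A) be positive. Then there is an asymptotically additive γ : ∏_m E_m → 𝓜(A) such that γ(x) − q·α(x)·q lies in the canonical image of A in 𝓜(A) for every x ∈ ∏_m E_m. -/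
open scoped MultiplierAlgebra

section

open Filter Finset Topology

/-- A strictly increasing sequence of cut points `N` has an index function `κ` that is equal to
`k` on each block `[N k, N (k + 1))`. -/
theorem StrictMono.exists_block_index {N : ℕ → ℕ} (hN : StrictMono N) :
    ∃ κ : ℕ → ℕ, Tendsto κ atTop atTop ∧ ∀ k m, N k ≤ m → m < N (k + 1) → κ m = k := by
  refine ⟨fun m => Nat.findGreatest (fun k => N k ≤ m) m, ?_, ?_⟩
  · refine Filter.tendsto_atTop.2 fun K => ?_
    filter_upwards [eventually_ge_atTop (N K)] with m hm
    exact Nat.le_findGreatest (hN.le_apply.trans hm) hm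
  · intro k m hk hm
    refine le_antisymm ?_ (Nat.le_findGreatest (hN.le_apply.trans hk) hk)
    by_contra! hlt
    have h : N (Nat.findGreatest (fun k => N k ≤ m) m) ≤ m :=
      Nat.findGreatest_spec (P := fun k => N k ≤ m) (hN.le_apply.trans hk) hk
    have := hN.monotone (Nat.succ_le_of_lt hlt)
    simp only [Nat.succ_eq_add_one] at this
    omega

section Series

variable {V : Type*} [SeminormedAddCommGroup V] {E : ℕ → Type*}

/-- If the series `∑ f m (x m)` is Cauchy for every `x ∈ ∏ m, E m`, then it is Cauchy uniformly
in `x`. -/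
theorem exists_forall_norm_sum_Ico_le_of_forall_cauchySeq (f : ∀ m, E m → V)
    (hf : ∀ x : ∀ m, E m, CauchySeq fun N => ∑ m ∈ range N, f m (x m)) {ε : ℝ} (hε : 0 < ε) :
    ∃ M, ∀ x : ∀ m, E m, ∀ i j, M ≤ i → i ≤ j → ‖∑ m ∈ Ico i j, f m (x m)‖ ≤ ε := by
  by_contra! h
  choose X i j hi hij hX using h
  have hlt : ∀ M, i M < j M := by
    intro M
    refine lt_of_le_of_ne (hij M) fun heq => ?_
    have := hX M
    rw [heq, Ico_self, sum_empty, norm_zero] at this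
    exact absurd this hε.not_gt
  let N : ℕ → ℕ := fun s => Nat.rec 0 (fun _ n => j n) s
  have hN : StrictMono N := strictMono_nat_of_lt_succ fun s => (hi (N s)).trans_lt (hlt (N s))
  obtain ⟨κ, -, hκ⟩ := hN.exists_block_index
  obtain ⟨S, hS⟩ := Metric.cauchySeq_iff.1 (hf fun m => X (N (κ m)) m) ε hε
  have hSi : S ≤ i (N S) := hN.le_apply.trans (hi _)
  have key := hS (j (N S)) (hSi.trans (hij _)) (i (N S)) hSi
  rw [dist_eq_norm, ← sum_Ico_eq_sub _ (hij _)] at key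
  refine lt_asymm key ?_
  convert hX (N S) using 2
  refine sum_congr rfl fun m hm => ?_
  rw [mem_Ico] at hm
  rw [hκ S m ((hi _).trans hm.1) hm.2]

/-- A diagonal argument: given countably many families of series that are Cauchy for every
`x ∈ ∏ m, E m`, one can pass from each family to the next one slowly enough to keep all the
series Cauchy. -/
theorem exists_tendsto_forall_cauchySeq_diagonal (h : ℕ → ∀ m, E m → V)
    (hh : ∀ k, ∀ x : ∀ m, E m, CauchySeq fun N => ∑ m ∈ range N, h k m (x m)) :
    ∃ κ : ℕ → ℕ, Tendsto κ atTop atTop ∧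
      ∀ x : ∀ m, E m, CauchySeq fun N => ∑ m ∈ range N, h (κ m) m (x m) := by
  choose P hP using fun k => exists_forall_norm_sum_Ico_le_of_forall_cauchySeq (h k) (hh k)
    (ε := (1 / 2) ^ k) (by positivity)
  let M : ℕ → ℕ := fun k => ∑ i ∈ range (k + 1), (P i + 1)
  have hM : StrictMono M := strictMono_nat_of_lt_succ fun k => by
    simp only [M, sum_range_succ _ (k + 1)]
    omega
  have hPM : ∀ k, P k ≤ M k := fun k => by
    simp only [M, sum_range_succ _ k]
    omega
  obtain ⟨κ, hκ, hκM⟩ := hM.exists_block_index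
  refine ⟨κ, hκ, fun x => ?_⟩
  have block : ∀ k a b, M k ≤ a → a ≤ b → b ≤ M (k + 1) →
      ‖∑ m ∈ Ico a b, h (κ m) m (x m)‖ ≤ (1 / 2) ^ k := by
    intro k a b hka hab hbk
    convert hP k x a b ((hPM k).trans hka) hab using 2
    refine sum_congr rfl fun m hm => ?_
    rw [mem_Ico] at hm
    rw [hκM k m (hka.trans hm.1) (hm.2.trans_le hbk)]
  have bound : ∀ K j a b, M K ≤ a → a ≤ b → b ≤ M (K + j) →
      ‖∑ m ∈ Ico a b, h (κ m) m (x m)‖ ≤ 2 * (1 / 2) ^ K - 2 * (1 / 2) ^ (K + j) := by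
    intro K j
    induction j with
    | zero =>
      intro a b hKa hab hb
      have : a = b := le_antisymm hab (hb.trans hKa)
      simp [this]
    | succ j ih =>
      intro a b hKa hab hb
      have e1 : (2 : ℝ) * (1 / 2) ^ K - 2 * (1 / 2) ^ (K + (j + 1)) =
          (2 * (1 / 2) ^ K - 2 * (1 / 2) ^ (K + j)) + (1 / 2) ^ (K + j) := by
        rw [← add_assoc, pow_succ]
        ring
      have hpow : (0 : ℝ) ≤ (1 / 2) ^ (K + j) := by positivity
      have hpow' : (1 / 2 : ℝ) ^ (K + j) ≤ (1 / 2) ^ K :=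
        pow_le_pow_of_le_one (by norm_num) (by norm_num) (Nat.le_add_right K j)
      rw [e1]
      rcases le_total b (M (K + j)) with hbM | hbM
      · exact (ih a b hKa hab hbM).trans (by linarith)
      rcases le_total (M (K + j)) a with haM | haM
      · exact (block _ a b haM hab hb).trans (by linarith)
      · rw [← sum_Ico_consecutive _ haM hbM]
        exact (norm_add_le _ _).trans (add_le_add (ih _ _ hKa haM le_rfl)
          (block _ _ _ le_rfl hbM hb))
  refine Metric.cauchySeq_iff'.2 fun ε hε => ?_
  obtain ⟨K, hK⟩ := exists_pow_lt_of_lt_one (half_pos hε) (by norm_num : (1 / 2 : ℝ) < 1)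
  refine ⟨M K, fun n hn => ?_⟩
  rw [dist_eq_norm, ← sum_Ico_eq_sub _ hn]
  have hnM : n ≤ M (K + n) := hM.le_apply.trans (hM.monotone (Nat.le_add_left n K))
  have hpow : (0 : ℝ) ≤ (1 / 2) ^ (K + n) := by positivity
  linarith [bound K n _ _ le_rfl hn hnM]

end Series

section Algebra

variable {A : Type*} [NonUnitalCStarAlgebra A] {E : ℕ → Type*}

/-- If the series `∑ F m (x m)` is left strictly Cauchy for every `x ∈ ∏ m, E m`, then all but
finitely many of the functions `F m` are bounded. -/
theorem eventually_bounded_of_forall_cauchySeq [∀ m, Nonempty (E m)] (F : ∀ m, E m → A)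
    (hF : ∀ x : ∀ m, E m, ∀ a : A, CauchySeq fun N => (∑ m ∈ range N, F m (x m)) * a) :
    ∀ᶠ m in atTop, ∃ C, ∀ v, ‖F m v‖ ≤ C := by
  have hx : ∀ m, ∃ v : E m, (¬ ∃ C, ∀ w, ‖F m w‖ ≤ C) → (m : ℝ) < ‖F m v‖ := by
    intro m
    by_cases hm : ∃ C, ∀ w, ‖F m w‖ ≤ C
    · exact ⟨Classical.arbitrary _, fun h => absurd hm h⟩
    · push Not at hm
      obtain ⟨v, hv⟩ := hm m
      exact ⟨v, fun _ => hv⟩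
  choose x hx using hx
  obtain ⟨C, hC⟩ := banach_steinhaus (g := fun m => ContinuousLinearMap.mul ℂ A (F m (x m)))
    fun a => by
      obtain ⟨R, -, hR⟩ := cauchySeq_bdd (hF x a)
      refine ⟨R, fun m => ?_⟩
      have := (hR (m + 1) m).le
      rwa [dist_eq_norm, ← sub_mul, sum_range_succ_sub_sum] at this
  filter_upwards [eventually_ge_atTop ⌈C⌉₊] with m hm
  by_contra hb
  have h1 := hC m
  rw [ContinuousLinearMap.opNorm_mul_apply] at h1
  exact absurd (hx m hb) (not_lt.2 (h1.trans ((Nat.le_ceil C).trans (by exact_mod_cast hm))))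

theorem DoubleCentralizer.fst_mul_apply (q : 𝓜(ℂ, A)) (a b : A) : q.fst (a * b) = q.fst a * b := by
  have h : ∀ c, c * (q.fst (a * b) - q.fst a * b) = 0 := fun c => by
    rw [mul_sub, ← q.central, ← mul_assoc c, ← q.central, mul_assoc, sub_self]
  exact sub_eq_zero.1 (CStarRing.star_mul_self_eq_zero_iff _ |>.1 (h _))

theorem DoubleCentralizer.snd_mul_apply (q : 𝓜(ℂ, A)) (a b : A) : q.snd (a * b) = a * q.snd b := by
  have h : ∀ c, (q.snd (a * b) - a * q.snd b) * c = 0 := fun c => by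
    rw [sub_mul, q.central, mul_assoc a (q.snd b), q.central, mul_assoc, sub_self]
  exact sub_eq_zero.1 (CStarRing.mul_star_self_eq_zero_iff _ |>.1 (h _))

/-- Compressing by `f - g` differs from the identity by terms that only involve `g`, up to an
error controlled by how well `f` acts as a unit. -/
theorem norm_sub_compress_sub_le {f g b : A} {δ : ℝ} (hf : ‖f‖ ≤ 1) (hg : ‖g‖ ≤ 1)
    (hl : ‖f * b - b‖ ≤ δ) (hr : ‖b * f - b‖ ≤ δ) :
    ‖(b - (f - g) * b * (f - g)) - (g * b + b * g - g * b * g)‖ ≤ 4 * δ := by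
  have e1 : (b - (f - g) * b * (f - g)) - (g * b + b * g - g * b * g) =
      (f * b - b) * g + g * (b * f - b) - f * (b * f - b) - (f * b - b) := by
    simp only [sub_mul, mul_sub, mul_assoc]
    abel
  have hδ : 0 ≤ δ := (norm_nonneg _).trans hl
  have h1 : ‖(f * b - b) * g‖ ≤ δ :=
    (norm_mul_le _ _).trans ((mul_le_mul hl hg (norm_nonneg _) hδ).trans_eq (mul_one δ))
  have h2 : ‖g * (b * f - b)‖ ≤ δ :=
    (norm_mul_le _ _).trans ((mul_le_mul hg hr (norm_nonneg _) zero_le_one).trans_eq (one_mul δ))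
  have h3 : ‖f * (b * f - b)‖ ≤ δ :=
    (norm_mul_le _ _).trans ((mul_le_mul hf hr (norm_nonneg _) zero_le_one).trans_eq (one_mul δ))
  rw [e1]
  have h4 := norm_sub_le ((f * b - b) * g + g * (b * f - b) - f * (b * f - b)) (f * b - b)
  have h5 := norm_sub_le ((f * b - b) * g + g * (b * f - b)) (f * (b * f - b))
  have h6 := norm_add_le ((f * b - b) * g) (g * (b * f - b))
  linarith

/-- If `∑ b m (x m)` is strictly Cauchy for every `x`, and for all but finitely many `m` the
sequence `e` acts as an approximate unit on the range of `b m` uniformly, then the summands can be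
compressed to corners given by intervals escaping to infinity, up to a norm convergent series. -/
theorem exists_intervals_cauchySeq_sub_compress {e : ℕ → A} (h_norm : ∀ n, ‖e n‖ ≤ 1)
    (b : ∀ m, E m → A)
    (hbl : ∀ x : ∀ m, E m, ∀ a : A, CauchySeq fun N => (∑ m ∈ range N, b m (x m)) * a)
    (hbr : ∀ x : ∀ m, E m, ∀ a : A, CauchySeq fun N => a * ∑ m ∈ range N, b m (x m))
    (hb : ∀ᶠ m in atTop, ∀ ε > (0 : ℝ), ∀ᶠ n in atTop, ∀ v,
      ‖e n * b m v - b m v‖ ≤ ε ∧ ‖b m v * e n - b m v‖ ≤ ε) :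
    ∃ l u : ℕ → ℕ, (∀ m, l m ≤ u m) ∧ Tendsto l atTop atTop ∧
      ∀ x : ∀ m, E m, CauchySeq fun N => ∑ m ∈ range N,
        (b m (x m) - (e (u m) - e (l m)) * b m (x m) * (e (u m) - e (l m))) := by
  obtain ⟨l, hl, hlc⟩ := exists_tendsto_forall_cauchySeq_diagonal
    (fun k m v => e k * b m v + b m v * e k - e k * b m v * e k) fun k x => by
      have hmul : UniformContinuous fun y : A => y * e k :=
        ((ContinuousLinearMap.mul ℂ A).flip (e k)).uniformContinuous
      have h := ((hbr x (e k)).add (hbl x (e k))).add (hmul.comp_cauchySeq (hbr x (e k))).neg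
      convert h using 2 with N
      simp [sum_add_distrib, mul_sum, sum_mul, sub_eq_add_neg]
  have hu : ∀ m, ∃ n, l m ≤ n ∧ ((∀ ε > (0 : ℝ), ∀ᶠ n in atTop, ∀ v,
      ‖e n * b m v - b m v‖ ≤ ε ∧ ‖b m v * e n - b m v‖ ≤ ε) →
      ∀ v, ‖e n * b m v - b m v‖ ≤ (1 / 2) ^ m ∧ ‖b m v * e n - b m v‖ ≤ (1 / 2) ^ m) := by
    intro m
    by_cases hm : ∀ ε > (0 : ℝ), ∀ᶠ n in atTop, ∀ v,
      ‖e n * b m v - b m v‖ ≤ ε ∧ ‖b m v * e n - b m v‖ ≤ ε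
    · obtain ⟨n, hn, hln⟩ :=
        ((hm ((1 / 2) ^ m) (by positivity)).and (eventually_ge_atTop (l m))).exists
      exact ⟨n, hln, fun _ => hn⟩
    · exact ⟨l m, le_rfl, fun h => absurd h hm⟩
  choose u hlu hu using hu
  refine ⟨l, u, hlu, hl, fun x => ?_⟩
  have hs : Summable fun m => (b m (x m) - (e (u m) - e (l m)) * b m (x m) * (e (u m) - e (l m)))
      - (e (l m) * b m (x m) + b m (x m) * e (l m) - e (l m) * b m (x m) * e (l m)) := by
    refine .of_norm_bounded_eventually_nat
      (summable_geometric_two.mul_left 4) ?_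
    filter_upwards [hb] with m hm
    obtain ⟨h1, h2⟩ := hu m hm (x m)
    exact norm_sub_compress_sub_le (h_norm _) (h_norm _) h1 h2
  have key := hs.hasSum.tendsto_sum_nat.cauchySeq.add (hlc x)
  simpa only [Pi.add_def, ← sum_add_distrib, sub_add_cancel] using key

/-- Multiplying by `e n` on the left is asymptotically the identity, uniformly on sets of the form
`{c * y * d | ‖y‖ ≤ C}`. -/
theorem eventually_norm_mul_sub_le {e : ℕ → A} {c : A}
    (hc : Tendsto (fun n => e n * c) atTop (𝓝 c)) (d : A) (C : ℝ) {ε : ℝ} (hε : 0 < ε) :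
    ∀ᶠ n in atTop, ∀ y, ‖y‖ ≤ C → ‖e n * (c * y * d) - c * y * d‖ ≤ ε := by
  have h : Tendsto (fun n => ‖e n * c - c‖ * (C * ‖d‖)) atTop (𝓝 0) := by
    simpa using (tendsto_iff_norm_sub_tendsto_zero.1 hc).mul_const (C * ‖d‖)
  filter_upwards [h.eventually (ge_mem_nhds hε)] with n hn y hy
  refine le_trans ?_ hn
  have e1 : e n * (c * y * d) - c * y * d = (e n * c - c) * (y * d) := by
    simp only [sub_mul, mul_assoc]
  rw [e1]
  refine (norm_mul_le _ _).trans (mul_le_mul_of_nonneg_left ?_ (norm_nonneg _))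
  exact (norm_mul_le _ _).trans (mul_le_mul_of_nonneg_right hy (norm_nonneg _))

/-- Multiplying by `e n` on the right is asymptotically the identity, uniformly on sets of the form
`{c * y * d | ‖y‖ ≤ C}`. -/
theorem eventually_norm_mul_sub_le' {e : ℕ → A} {d : A}
    (hd : Tendsto (fun n => d * e n) atTop (𝓝 d)) (c : A) (C : ℝ) {ε : ℝ} (hε : 0 < ε) :
    ∀ᶠ n in atTop, ∀ y, ‖y‖ ≤ C → ‖c * y * d * e n - c * y * d‖ ≤ ε := by
  have h : Tendsto (fun n => ‖c‖ * C * ‖d * e n - d‖) atTop (𝓝 0) := by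
    simpa using (tendsto_iff_norm_sub_tendsto_zero.1 hd).const_mul (‖c‖ * C)
  filter_upwards [h.eventually (ge_mem_nhds hε)] with n hn y hy
  refine le_trans ?_ hn
  have e1 : c * y * d * e n - c * y * d = c * y * (d * e n - d) := by
    simp only [mul_sub, mul_assoc]
  rw [e1]
  refine (norm_mul_le _ _).trans (mul_le_mul_of_nonneg_right ?_ (norm_nonneg _))
  exact (norm_mul_le _ _).trans (mul_le_mul_of_nonneg_left hy (norm_nonneg _))

theorem mul_eq_of_lt_of_forall_succ_mul {e : ℕ → A} (h_mul : ∀ n, e (n + 1) * e n = e n)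
    {k n : ℕ} (h : k < n) : e n * e k = e k := by
  induction n, h using Nat.le_induction with
  | base => exact h_mul k
  | succ n _ ih => rw [← ih, ← mul_assoc, h_mul]

end Algebra

end

open Filter in
/-- `α : ∏ m, E m → 𝓜(ℂ, A)` is asymptotically additive (with respect to the approximate
identity `e`) if there are finite intervals `I m = [l m, u m]` with `min I m → ∞` and functions
`F m : E m → e_{I m} A e_{I m}` (where `e_I = e (max I) − e (min I)`) such that for every
`x ∈ ∏ m, E m` the series `∑ m, F m (x m)` converges strictly to `α x`; strict convergence of
the partial sums `s N` to `b ∈ 𝓜(ℂ, A)` means that for every `a ∈ A`, `s N · a → b · a` and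
`a · s N → a · b` in norm (the left and right actions of `𝓜(ℂ, A)` on `A` being given by the
first and second coordinates of a double centralizer). -/
def AsymptoticallyAdditive {A : Type*} [NonUnitalCStarAlgebra A] (e : ℕ → A)
    (E : ℕ → Type*) [∀ m, NormedAddCommGroup (E m)] [∀ m, NormedSpace ℂ (E m)]
    (α : (∀ m, E m) → 𝓜(ℂ, A)) : Prop :=
  ∃ (l u : ℕ → ℕ) (F : ∀ m, E m → A),
    (∀ m, l m ≤ u m) ∧
    Tendsto l atTop atTop ∧
    (∀ m (v : E m), ∃ a : A,
      F m v = (e (u m) - e (l m)) * a * (e (u m) - e (l m))) ∧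
    (∀ x : ∀ m, E m, ∀ a : A,
      Tendsto (fun N => (∑ m ∈ Finset.range N, F m (x m)) * a) atTop
        (nhds ((α x).fst a)) ∧
      Tendsto (fun N => a * ∑ m ∈ Finset.range N, F m (x m)) atTop
        (nhds ((α x).snd a)))

open Filter in
/-- If `α` is asymptotically additive and `q ∈ 𝓜(ℂ, A)` is positive, then there is an
asymptotically additive `γ` with `γ x − q·α x·q` in the canonical image of `A` for all `x`. -/
theorem exists_asymptoticallyAdditive_congr_corner {A : Type*} [NonUnitalCStarAlgebra A]
    [PartialOrder A] [StarOrderedRing A]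
    (e : ℕ → A)
    (h_ai : ∀ a : A, Tendsto (fun n => e n * a) atTop (nhds a) ∧
      Tendsto (fun n => a * e n) atTop (nhds a))
    (h_pos : ∀ n, 0 ≤ e n) (h_norm : ∀ n, ‖e n‖ ≤ 1)
    (h_mono : ∀ n, e n ≤ e (n + 1)) (h_mul : ∀ n, e (n + 1) * e n = e n)
    (E : ℕ → Type*) [∀ m, NormedAddCommGroup (E m)] [∀ m, NormedSpace ℂ (E m)]
    [∀ m, FiniteDimensional ℂ (E m)]
    (α : (∀ m, E m) → 𝓜(ℂ, A)) (hα : AsymptoticallyAdditive e E α)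
    (q : 𝓜(ℂ, A)) (hq : ∃ r : 𝓜(ℂ, A), q = star r * r) :
    ∃ γ : (∀ m, E m) → 𝓜(ℂ, A), AsymptoticallyAdditive e E γ ∧
      ∀ x : ∀ m, E m, γ x - q * α x * q ∈ Set.range ((↑) : A → 𝓜(ℂ, A)) := by
  obtain ⟨l, u, F, hlu, -, hF, hα⟩ := hα
  have hsa : ∀ n, star (e n) = e n := fun n => (IsSelfAdjoint.of_nonneg (h_pos n)).star_eq
  have hmul' : ∀ {k n : ℕ}, k < n → e k * e n = e k := fun {k n} h => by
    simpa [hsa] using congrArg star (mul_eq_of_lt_of_forall_succ_mul h_mul h)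
  have hcF : ∀ m v, e (u m + 1) * F m v * e (u m + 1) = F m v := by
    intro m v
    obtain ⟨a, ha⟩ := hF m v
    have h1 : e (u m + 1) * (e (u m) - e (l m)) = e (u m) - e (l m) := by
      rw [mul_sub, h_mul, mul_eq_of_lt_of_forall_succ_mul h_mul (Nat.lt_succ_of_le (hlu m))]
    have h2 : (e (u m) - e (l m)) * e (u m + 1) = e (u m) - e (l m) := by
      rw [sub_mul, hmul' (Nat.lt_succ_self _), hmul' (Nat.lt_succ_of_le (hlu m))]
    rw [ha, mul_assoc _ _ (e (u m + 1)), mul_assoc _ _ (e (u m + 1)), h2, ← mul_assoc, ← mul_assoc,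
      h1]
  have hbF : ∀ m v, q.snd (q.fst (F m v)) =
      q.fst (e (u m + 1)) * F m v * q.snd (e (u m + 1)) := fun m v => by
    conv_lhs => rw [← hcF m v]
    rw [mul_assoc, q.fst_mul_apply, ← mul_assoc, q.snd_mul_apply]
  have hl : ∀ (x : ∀ m, E m) (a : A),
      Tendsto (fun N => (∑ m ∈ Finset.range N, q.snd (q.fst (F m (x m)))) * a) atTop
        (nhds ((q * α x * q).fst a)) := fun x a => by
    refine ((q.fst.continuous.tendsto _).comp (hα x (q.fst a)).1).congr fun N => ?_
    simp only [Function.comp_apply]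
    rw [q.fst_mul_apply, ← q.central, map_sum, map_sum]
  have hr : ∀ (x : ∀ m, E m) (a : A),
      Tendsto (fun N => a * ∑ m ∈ Finset.range N, q.snd (q.fst (F m (x m)))) atTop
        (nhds ((q * α x * q).snd a)) := fun x a => by
    refine ((q.snd.continuous.tendsto _).comp (hα x (q.snd a)).2).congr fun N => ?_
    simp only [Function.comp_apply]
    rw [q.central, q.snd_mul_apply, map_sum, map_sum]
  have hbdd := eventually_bounded_of_forall_cauchySeq F fun x a => (hα x a).1.cauchySeq
  obtain ⟨l', u', hlu', hl', hc⟩ := exists_intervals_cauchySeq_sub_compress h_norm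
    (fun m v => q.snd (q.fst (F m v))) (fun x a => (hl x a).cauchySeq)
    (fun x a => (hr x a).cauchySeq) (by
      filter_upwards [hbdd] with m ⟨C, hC⟩ ε hε
      filter_upwards [eventually_norm_mul_sub_le (h_ai (q.fst (e (u m + 1)))).1
          (q.snd (e (u m + 1))) C hε,
        eventually_norm_mul_sub_le' (h_ai (q.snd (e (u m + 1)))).2
          (q.fst (e (u m + 1))) C hε] with n h1 h2 v
      rw [hbF]
      exact ⟨h1 _ (hC v), h2 _ (hC v)⟩)
  choose d hd using fun x => cauchySeq_tendsto_of_complete (hc x)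
  refine ⟨fun x => q * α x * q - (d x : 𝓜(ℂ, A)), ⟨l', u', fun m v =>
    (e (u' m) - e (l' m)) * q.snd (q.fst (F m v)) * (e (u' m) - e (l' m)), hlu', hl',
    fun m v => ⟨_, rfl⟩, fun x a => ⟨?_, ?_⟩⟩, fun x => ⟨-d x, ?_⟩⟩
  · refine ((hl x a).sub ((hd x).mul_const a)).congr fun N => ?_
    rw [← sub_mul, ← Finset.sum_sub_distrib]
    simp only [sub_sub_cancel]
  · refine ((hr x a).sub ((hd x).const_mul a)).congr fun N => ?_
    rw [← mul_sub, ← Finset.sum_sub_distrib]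
    simp only [sub_sub_cancel]
  · rw [sub_sub_cancel_left]
    exact map_neg (DoubleCentralizer.coeHom (𝕜 := ℂ) (A := A)) (d x)
end

section
/- Let A be a C*-algebra and p ∈ A a projection (p = p* and p² = p) which is not central, i.e., there exists x ∈ A with p·x ≠ x·p. Then there is a ∈ A with ‖a‖ ≤ 1 and ‖p·a − a·p‖ > 1/2. -/
/-- If the commutator of `p` with some `y ≠ 0` has the same norm as `y`, then normalizing `y` gives
a contraction whose commutator with `p` has norm `1`. -/
theorem exists_norm_le_one_commutator_eq_one {A : Type*} [NonUnitalNormedRing A]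
    [NormedSpace ℂ A] [IsScalarTower ℂ A A] [SMulCommClass ℂ A A] {p y : A} (hy : y ≠ 0)
    (h : ‖p * y - y * p‖ = ‖y‖) : ∃ a : A, ‖a‖ ≤ 1 ∧ ‖p * a - a * p‖ = 1 := by
  have hy' : ‖y‖ ≠ 0 := norm_ne_zero_iff.mpr hy
  have hn : ∀ z : A, ‖((‖y‖⁻¹ : ℝ) : ℂ) • z‖ = ‖y‖⁻¹ * ‖z‖ := fun z ↦ by
    rw [norm_smul, Complex.norm_real, norm_inv, norm_norm]
  refine ⟨((‖y‖⁻¹ : ℝ) : ℂ) • y, ?_, ?_⟩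
  · rw [hn, inv_mul_cancel₀ hy']
  · rw [mul_smul_comm, smul_mul_assoc, ← smul_sub, hn, h, inv_mul_cancel₀ hy']

/-- If `p` is a non-central projection in a C*-algebra `A`, then there is a contraction `a ∈ A`
with `‖p·a − a·p‖ > 1/2`. -/
theorem exists_contraction_commutator_gt_half {A : Type*} [NonUnitalCStarAlgebra A]
    (p : A) (hp_star : star p = p) (hp_idem : p * p = p)
    (hp_noncentral : ∃ x : A, p * x ≠ x * p) :
    ∃ a : A, ‖a‖ ≤ 1 ∧ 1 / 2 < ‖p * a - a * p‖ := by
  obtain ⟨x, hx⟩ := hp_noncentral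
  obtain ⟨y, hy, hcomm⟩ : ∃ y : A, y ≠ 0 ∧ ‖p * y - y * p‖ = ‖y‖ := by
    by_cases h : p * x - p * x * p = 0
    · refine ⟨x * p - p * x * p, fun h' ↦ hx ?_, ?_⟩
      · rw [sub_eq_zero.mp h, sub_eq_zero.mp h']
      · rw [← norm_neg]
        congr 1
        simp [mul_sub, sub_mul, mul_assoc, hp_idem, ← mul_assoc p p]
    · refine ⟨p * x - p * x * p, h, ?_⟩
      congr 1
      simp [mul_sub, sub_mul, mul_assoc, hp_idem, ← mul_assoc p p]
  obtain ⟨a, ha, hpa⟩ := exists_norm_le_one_commutator_eq_one hy hcomm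
  exact ⟨a, ha, by rw [hpa]; norm_num⟩
end

section
/- Let (A_n)_{n∈ℕ} be unital C*-algebras such that, for each n, every central projection of A_n equals 0 or 1. Let (q_n) ∈ ∏_n A_n satisfy sup_n ‖q_n‖ < ∞, ‖q_n* − q_n‖ → 0, ‖q_n² − q_n‖ → 0, and, for every sequence (a_n) with a_n ∈ A_n and ‖a_n‖ ≤ 1 for all n, ‖q_n·a_n − a_n·q_n‖ → 0. Then there is a set X ⊆ ℕ such that ‖q_n − c_n‖ → 0, where c_n = 1 (the unit of A_n) if n ∈ X and c_n = 0 otherwise. (Equivalently: the only central projections of the reduced product ∏ A_n / ⊕ A_n are the images of the projections p_X = (χ_X(n)·1)_n.) -/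
/-- An almost idempotent self-adjoint element of a C*-algebra is close to a projection. -/
theorem IsSelfAdjoint.exists_projection_near {A : Type*} [CStarAlgebra A] {b : A}
    (hb : IsSelfAdjoint b) (h : ‖b * b - b‖ < 1 / 4) :
    ∃ p : A, star p = p ∧ p * p = p ∧ ‖p - b‖ ≤ 2 * ‖b * b - b‖ := by
  have hspec : ∀ x ∈ spectrum ℝ b, |x * x - x| ≤ ‖b * b - b‖ := by
    have hcfc : cfc (fun x : ℝ => x * x - x) b = b * b - b := by
      rw [cfc_sub (fun x : ℝ => x * x) (fun x => x) b, cfc_mul (fun x : ℝ => x) (fun x => x) b,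
        cfc_id' ℝ b]
    intro x hx
    rw [← hcfc, ← Real.norm_eq_abs]
    exact norm_apply_le_norm_cfc (fun x : ℝ => x * x - x) b hx
  let f : ℝ → ℝ := fun x => if 1 / 2 < x then 1 else 0
  have hf : ContinuousOn f (spectrum ℝ b) := by
    intro x hx
    refine ContinuousAt.continuousWithinAt ?_
    have hx' := hspec x hx
    rcases lt_trichotomy x (1 / 2) with hlt | rfl | hgt
    · refine (continuousAt_const (y := (0 : ℝ))).congr ?_
      filter_upwards [Iio_mem_nhds hlt] with y hy
      exact (if_neg (not_lt.2 (le_of_lt hy))).symm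
    · norm_num at hx' h
      linarith
    · refine (continuousAt_const (y := (1 : ℝ))).congr ?_
      filter_upwards [Ioi_mem_nhds hgt] with y hy
      exact (if_pos hy).symm
  refine ⟨cfc f b, cfc_predicate f b, ?_, ?_⟩
  · rw [← cfc_mul f f b]
    congr 1
    ext x
    simp [f]
  · have hsub : cfc f b - b = cfc (fun x => f x - x) b := by
      rw [cfc_sub f (fun x => x) b, cfc_id' ℝ b]
    rw [hsub]
    refine norm_cfc_le (by positivity) fun x hx => ?_
    refine le_trans ?_ (mul_le_mul_of_nonneg_left (hspec x hx) zero_le_two)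
    rw [Real.norm_eq_abs, show x * x - x = x * (x - 1) by ring, abs_mul]
    by_cases hx2 : 1 / 2 < x
    · simp only [f, if_pos hx2]
      rw [abs_sub_comm, abs_of_pos (by linarith : 0 < x)]
      nlinarith [abs_nonneg (x - 1)]
    · simp only [f, if_neg hx2]
      rw [zero_sub, abs_neg, abs_of_nonpos (by linarith : x - 1 ≤ 0)]
      nlinarith [abs_nonneg x]

/-- A projection whose commutators with the unit ball all have norm less than `1` is central. -/
theorem commute_of_norm_commutator_lt_one {A : Type*} [CStarAlgebra A] {p : A}
    (hp : p * p = p) (h : ∀ x : A, ‖x‖ ≤ 1 → ‖p * x - x * p‖ < 1) (x : A) :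
    p * x = x * p := by
  have key : ∀ y : A, ‖p * y - y * p‖ = ‖y‖ → y = 0 := by
    intro y hy
    by_contra hy0
    have hn : ‖y‖ ≠ 0 := norm_ne_zero_iff.2 hy0
    have hunit : ‖((‖y‖⁻¹ : ℝ) : ℂ) • y‖ = 1 := by
      simp [norm_smul, hn]
    have hlt := h _ hunit.le
    rw [mul_smul_comm, smul_mul_assoc, ← smul_sub, norm_smul, hy, ← norm_smul, hunit] at hlt
    exact lt_irrefl _ hlt
  have h₁ : p * x - p * x * p = 0 := by
    refine key _ (congrArg _ ?_)
    simp only [mul_sub, sub_mul, ← mul_assoc, hp]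
    simp only [mul_assoc, hp]
    abel
  have h₂ : x * p - p * x * p = 0 := by
    refine key _ ?_
    rw [← norm_neg]
    refine congrArg _ ?_
    simp only [mul_sub, sub_mul, ← mul_assoc, hp]
    simp only [mul_assoc, hp]
    abel
  exact (sub_eq_zero.1 h₁).trans (sub_eq_zero.1 h₂).symm

/-- A bounded element which is almost self-adjoint and almost idempotent is close to a
projection. -/
theorem exists_projection_near {A : Type*} [CStarAlgebra A] {q : A} {C : ℝ} (hq : ‖q‖ ≤ C)
    (h : ‖q * q - q‖ + (2 * C + 1) * ‖star q - q‖ + ‖star q - q‖ ^ 2 < 1 / 4) :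
    ∃ p : A, star p = p ∧ p * p = p ∧
      ‖q - p‖ ≤
        2 * (‖q * q - q‖ + (2 * C + 1) * ‖star q - q‖ + ‖star q - q‖ ^ 2) + ‖star q - q‖ := by
  set e : A := (1 / 2 : ℝ) • (star q - q) with he
  have hnorm : ‖e‖ ≤ ‖star q - q‖ := by
    rw [he, norm_smul, Real.norm_of_nonneg (by norm_num)]
    linarith [norm_nonneg (star q - q)]
  have hb : IsSelfAdjoint (q + e) := by
    have : q + e = (1 / 2 : ℝ) • (q + star q) := by
      rw [he]; module
    rw [this]
    exact (IsSelfAdjoint.all (1 / 2 : ℝ)).smul (IsSelfAdjoint.add_star_self q)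
  have hidem : ‖(q + e) * (q + e) - (q + e)‖ ≤
      ‖q * q - q‖ + (2 * C + 1) * ‖star q - q‖ + ‖star q - q‖ ^ 2 := by
    have hC : 0 ≤ C := (norm_nonneg q).trans hq
    calc ‖(q + e) * (q + e) - (q + e)‖
        = ‖(q * q - q) + q * e + e * q + e * e - e‖ := by congr 1; noncomm_ring
      _ ≤ ‖q * q - q‖ + ‖q * e‖ + ‖e * q‖ + ‖e * e‖ + ‖e‖ :=
        (norm_sub_le _ _).trans (add_le_add_left norm_add₄_le _)
      _ ≤ ‖q * q - q‖ + C * ‖star q - q‖ + ‖star q - q‖ * C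
          + ‖star q - q‖ * ‖star q - q‖ + ‖star q - q‖ := by
        gcongr <;> refine (norm_mul_le _ _).trans ?_ <;> gcongr
      _ = _ := by ring
  obtain ⟨p, hp₁, hp₂, hp₃⟩ := hb.exists_projection_near (hidem.trans_lt h)
  refine ⟨p, hp₁, hp₂, ?_⟩
  calc ‖q - p‖ = ‖(p - (q + e)) + e‖ := by rw [norm_sub_rev]; congr 1; abel
    _ ≤ ‖p - (q + e)‖ + ‖e‖ := norm_add_le _ _
    _ ≤ _ := by gcongr; exact hp₃.trans (by gcongr)

/-- Asymptotic commutation with every sequence in the unit balls is uniform over the balls. -/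
theorem eventually_forall_norm_commutator_lt {A : ℕ → Type*} [∀ n, CStarAlgebra (A n)]
    {q : ∀ n, A n}
    (hcentral : ∀ a : ∀ n, A n, (∀ n, ‖a n‖ ≤ 1) →
      Filter.Tendsto (fun n => ‖q n * a n - a n * q n‖) Filter.atTop (nhds 0))
    {ε : ℝ} (hε : 0 < ε) :
    ∀ᶠ n in Filter.atTop, ∀ x : A n, ‖x‖ ≤ 1 → ‖q n * x - x * q n‖ < ε := by
  have hex : ∀ n, ∃ a : A n, ‖a‖ ≤ 1 ∧ (‖q n * a - a * q n‖ < ε →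
      ∀ x : A n, ‖x‖ ≤ 1 → ‖q n * x - x * q n‖ < ε) := by
    intro n
    by_cases hn : ∀ x : A n, ‖x‖ ≤ 1 → ‖q n * x - x * q n‖ < ε
    · exact ⟨0, by simp, fun _ => hn⟩
    · push Not at hn
      obtain ⟨a, ha, hle⟩ := hn
      exact ⟨a, ha, fun hlt => absurd hlt hle.not_gt⟩
  choose a ha hlt using hex
  filter_upwards [(hcentral a ha).eventually_lt_const hε] with n hn using hlt n hn


open scoped Classical in
/-- Let `(A n)` be unital C*-algebras with no nontrivial central projections, and let
`(q n) ∈ ∏ A n` be a bounded sequence which is asymptotically self-adjoint, asymptotically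
idempotent, and asymptotically central (it asymptotically commutes with every bounded
sequence).  Then `q n` is asymptotically close to the sequence which is `1` on some set
`X ⊆ ℕ` and `0` off it; i.e. the only central projections of `∏ A n / ⊕ A n` are the images
of the `p_X`. -/
theorem central_projection_of_reduced_product
    (A : ℕ → Type*) [∀ n, CStarAlgebra (A n)]
    (hA : ∀ n, ∀ p : A n, star p = p → p * p = p → (∀ x : A n, p * x = x * p) →
      p = 0 ∨ p = 1)
    (q : ∀ n, A n)
    (hbdd : ∃ C : ℝ, ∀ n, ‖q n‖ ≤ C)
    (hstar : Filter.Tendsto (fun n => ‖star (q n) - q n‖) Filter.atTop (nhds 0))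
    (hidem : Filter.Tendsto (fun n => ‖q n * q n - q n‖) Filter.atTop (nhds 0))
    (hcentral : ∀ a : ∀ n, A n, (∀ n, ‖a n‖ ≤ 1) →
      Filter.Tendsto (fun n => ‖q n * a n - a n * q n‖) Filter.atTop (nhds 0)) :
    ∃ X : Set ℕ,
      Filter.Tendsto (fun n => ‖q n - (if n ∈ X then 1 else 0)‖) Filter.atTop (nhds 0) := by
  obtain ⟨C, hC⟩ := hbdd
  set δ : ℕ → ℝ := fun n => ‖q n * q n - q n‖ + (2 * C + 1) * ‖star (q n) - q n‖
    + ‖star (q n) - q n‖ ^ 2 with hδ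
  set η : ℕ → ℝ := fun n => 2 * δ n + ‖star (q n) - q n‖ with hη
  have hδ0 : Filter.Tendsto δ Filter.atTop (nhds 0) := by
    simpa using (hidem.add (hstar.const_mul (2 * C + 1))).add (hstar.pow 2)
  have hη0 : Filter.Tendsto η Filter.atTop (nhds 0) := by
    simpa using (hδ0.const_mul 2).add hstar
  refine ⟨{n | ‖q n - 1‖ ≤ η n}, ?_⟩
  refine squeeze_zero' (Filter.Eventually.of_forall fun n => norm_nonneg _) ?_ hη0
  filter_upwards [hδ0.eventually_lt_const (by norm_num : (0 : ℝ) < 1 / 4),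
    hη0.eventually_lt_const (by norm_num : (0 : ℝ) < 1 / 4),
    eventually_forall_norm_commutator_lt hcentral (by norm_num : (0 : ℝ) < 1 / 2)]
    with n hδn hηn hcomm
  obtain ⟨p, hp₁, hp₂, hp₃⟩ := exists_projection_near (hC n) hδn
  change ‖q n - p‖ ≤ η n at hp₃
  have hp : ∀ x : A n, ‖x‖ ≤ 1 → ‖p * x - x * p‖ < 1 := by
    intro x hx
    have hl : ‖(q n - p) * x‖ ≤ ‖q n - p‖ :=
      (norm_mul_le _ _).trans (mul_le_of_le_one_right (norm_nonneg _) hx)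
    have hr : ‖x * (q n - p)‖ ≤ ‖q n - p‖ :=
      (norm_mul_le _ _).trans (mul_le_of_le_one_left (norm_nonneg _) hx)
    calc ‖p * x - x * p‖
        = ‖(q n * x - x * q n) - (q n - p) * x + x * (q n - p)‖ := by congr 1; noncomm_ring
      _ ≤ ‖q n * x - x * q n‖ + ‖(q n - p) * x‖ + ‖x * (q n - p)‖ :=
        (norm_add_le _ _).trans (add_le_add_left (norm_sub_le _ _) _)
      _ < 1 := by linarith [hcomm x hx]
  by_cases hn : ‖q n - 1‖ ≤ η n
  · simp [hn]
  · rcases hA n p hp₁ hp₂ (commute_of_norm_commutator_lt_one hp₂ hp) with rfl | rfl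
    · simpa [hn] using hp₃
    · exact absurd hp₃ hn
end

section
/- There is a constant K > 0 such that for every ε with 0 < ε < 1/4, every finite-dimensional C*-algebra A, every C*-algebra B, and every ε-*-homomorphism φ : A → B, there is a *-homomorphism ψ : A → B such that ‖φ(x) − ψ(x)‖ < K·√ε for all x in the closed unit ball of A. Moreover, there is ε₀ > 0 such that if in addition ε < ε₀ and φ is an ε-isomorphism, then ψ can be chosen to be a *-isomorphism of A onto B. -/
section ApproxMaps

variable {A B : Type*} [NonUnitalCStarAlgebra A] [NonUnitalCStarAlgebra B]

/-- `φ` is `ε`-linear. -/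
def EpsLinear (ε : ℝ) (φ : A → B) : Prop :=
  ∀ x y : A, ‖x‖ ≤ 1 → ‖y‖ ≤ 1 → ∀ lam mu : ℂ, ‖lam‖ ≤ 1 → ‖mu‖ ≤ 1 →
    ‖φ (lam • x + mu • y) - (lam • φ x + mu • φ y)‖ < ε

/-- `φ` is `ε`-`*`-preserving. -/
def EpsStarPreserving (ε : ℝ) (φ : A → B) : Prop :=
  ∀ x : A, ‖x‖ ≤ 1 → ‖φ (star x) - star (φ x)‖ < ε

/-- `φ` is `ε`-multiplicative. -/
def EpsMultiplicative (ε : ℝ) (φ : A → B) : Prop :=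
  ∀ x y : A, ‖x‖ ≤ 1 → ‖y‖ ≤ 1 → ‖φ (x * y) - φ x * φ y‖ < ε

/-- `φ` is `ε`-isometric. -/
def EpsIsometric (ε : ℝ) (φ : A → B) : Prop :=
  ∀ x : A, ‖x‖ ≤ 1 → |‖x‖ - ‖φ x‖| < ε

/-- `φ` is `ε`-surjective. -/
def EpsSurjective (ε : ℝ) (φ : A → B) : Prop :=
  ∀ b : B, ‖b‖ ≤ 1 → ∃ x : A, ‖x‖ ≤ 1 ∧ ‖b - φ x‖ < ε

/-- An `ε`-`*`-homomorphism: a contraction on the unit ball which is `ε`-linear,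
`ε`-`*`-preserving and `ε`-multiplicative. -/
def EpsStarHom (ε : ℝ) (φ : A → B) : Prop :=
  (∀ x : A, ‖x‖ ≤ 1 → ‖φ x‖ ≤ 1) ∧ EpsLinear ε φ ∧ EpsStarPreserving ε φ ∧
    EpsMultiplicative ε φ

/-- An `ε`-embedding: an `ε`-`*`-homomorphism which is `ε`-isometric. -/
def EpsEmbedding (ε : ℝ) (φ : A → B) : Prop :=
  EpsStarHom ε φ ∧ EpsIsometric ε φ

/-- An `ε`-isomorphism: an `ε`-embedding which is `ε`-surjective. -/
def EpsIsomorphism (ε : ℝ) (φ : A → B) : Prop :=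
  EpsEmbedding ε φ ∧ EpsSurjective ε φ

end ApproxMaps

section Stability

open MeasureTheory Topology Filter

section ApproxRep

variable {G B : Type*} [Group G] [TopologicalSpace G] [NonUnitalCStarAlgebra B]

/-- A continuous map `f` from a group to a C*-algebra, compatible with `*`, supported on the
projection `q = f 1`, and multiplicative up to an error `η`. -/
structure IsApproxRep (q : B) (η : ℝ) (f : G → B) : Prop where
  continuous : Continuous f
  map_one : f 1 = q
  mul_left : ∀ x, q * f x = f x
  map_inv : ∀ x, f x⁻¹ = star (f x)
  defect : ∀ x y, ‖f (x * y) - f x * f y‖ ≤ η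

namespace IsApproxRep

variable {q : B} {η : ℝ} {f : G → B}

theorem star_eq (h : IsApproxRep q η f) : star q = q := by
  have := h.map_inv 1
  rwa [inv_one, h.map_one, eq_comm] at this

theorem mul_right (h : IsApproxRep q η f) (x : G) : f x * q = f x := by
  have := congrArg star (h.mul_left x⁻¹)
  rwa [star_mul, h.map_inv, star_star, h.star_eq] at this

/-- The first-order correction to an approximate representation. -/
theorem exists_correction [IsTopologicalGroup G] [CompactSpace G]
    [SecondCountableTopology G] (h : IsApproxRep q η f) (hf : ∀ x, ‖f x‖ ≤ 2) :
    ∃ c : G → B, Continuous c ∧ c 1 = 0 ∧ (∀ x, q * c x = c x) ∧ (∀ x, c x * q = c x) ∧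
      (∀ x, ‖c x‖ ≤ 2 * η) ∧
      ∀ x z, ‖f (x * z) - f x * f z + c (x * z) - f x * c z - c x * f z‖ ≤ 2 * η ^ 2 := by
  let _ : MeasurableSpace G := borel G
  have : BorelSpace G := ⟨rfl⟩
  let μ : Measure G := Measure.haarMeasure ⊤
  have : IsProbabilityMeasure μ := ⟨by
    have := Measure.haarMeasure_self (G := G) (K₀ := ⊤)
    simpa [μ] using this⟩
  have hη : 0 ≤ η := (norm_nonneg _).trans (h.defect 1 1)
  have hint : ∀ g : G → B, Continuous g → Integrable g μ := fun g hg =>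
    hg.integrable_of_hasCompactSupport (HasCompactSupport.of_compactSpace g)
  have hbd : ∀ (g : G → B) (C : ℝ), (∀ y, ‖g y‖ ≤ C) → ‖∫ y, g y ∂μ‖ ≤ C := fun g C hg => by
    simpa using norm_integral_le_of_norm_le_const (μ := μ) (Eventually.of_forall hg)
  have hfc := h.continuous
  let D : G → G → B := fun x y => f (x * y) - f x * f y
  have hD : ∀ x y, D x y = f (x * y) - f x * f y := fun _ _ => rfl
  have hDc : Continuous (Function.uncurry D) := by
    simp only [D, Function.uncurry_def]; fun_prop
  have hDb : ∀ x y, ‖D x y‖ ≤ η := h.defect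
  have hDc' : ∀ {a b : G → G}, Continuous a → Continuous b →
      Continuous fun y => D (a y) (b y) := fun ha hb => hDc.comp (ha.prodMk hb)
  let c : G → B := fun x => ∫ y, f y * D y⁻¹ x ∂μ
  have hc : ∀ x, c x = ∫ y, f y * D y⁻¹ x ∂μ := fun _ => rfl
  have hcint : ∀ x, Integrable (fun y => f y * D y⁻¹ x) μ := fun x =>
    hint _ (hfc.mul (hDc' continuous_inv continuous_const))
  have hqD : ∀ x z, q * D x z = D x z := fun x z => by
    simp only [D, mul_sub, ← mul_assoc, h.mul_left]
  have hDq : ∀ x z, D x z * q = D x z := fun x z => by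
    simp only [D, sub_mul, mul_assoc, h.mul_right]
  refine ⟨c, ?_, ?_, ?_, ?_, ?_, ?_⟩
  · have : Continuous (Function.uncurry fun x y => f y * D y⁻¹ x) := by
      simp only [D, Function.uncurry_def]; fun_prop
    have := continuous_parametric_integral_of_continuous (μ := μ) this isCompact_univ
    simpa [c] using this
  · simp [c, D, h.map_one, h.mul_right]
  · intro x
    rw [hc, ← integral_const_mul_of_integrable (hcint x)]
    simp only [← mul_assoc, h.mul_left]
  · intro x
    rw [hc, ← integral_mul_const_of_integrable (hcint x)]
    simp only [mul_assoc, hDq]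
  · intro x
    refine hbd _ _ fun y => (norm_mul_le _ _).trans ?_
    exact mul_le_mul (hf y) (hDb _ _) (norm_nonneg _) (by norm_num)
  · intro x z
    have e1 : f x * c z = ∫ y, f x * (f y * D y⁻¹ z) ∂μ :=
      (integral_const_mul_of_integrable (hcint z)).symm
    have e2 : c x * f z = ∫ y, (f y * D y⁻¹ x) * f z ∂μ :=
      (integral_mul_const_of_integrable (hcint x)).symm
    have e3 : ∫ y, f y * D (y⁻¹ * x) z ∂μ = ∫ y, f (x * y) * D y⁻¹ z ∂μ := by
      rw [← integral_mul_left_eq_self _ x]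
      simp
    have coc : ∀ y, (f y * D y⁻¹ x) * f z =
        f y * D y⁻¹ (x * z) + f y * f y⁻¹ * D x z - f y * D (y⁻¹ * x) z := fun y => by
      simp only [D, mul_sub, sub_mul, mul_assoc]
      abel
    have key : D x z + c (x * z) - f x * c z - c x * f z =
        (∫ y, D y y⁻¹ * D x z ∂μ) + ∫ y, D x y * D y⁻¹ z ∂μ := by
      have i1 : Integrable (fun y => f y * f y⁻¹ * D x z) μ := hint _ (by fun_prop)
      have i2 : Integrable (fun y => f y * D (y⁻¹ * x) z) μ := hint _
        (hfc.mul (hDc' (by fun_prop) (by fun_prop)))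
      have i3 : Integrable (fun y => f (x * y) * D y⁻¹ z) μ := hint _
        (by have := hDc' continuous_inv (continuous_const (y := z)); fun_prop)
      have i4 : Integrable (fun y => f x * (f y * D y⁻¹ z)) μ := hint _
        (by have := hDc' continuous_inv (continuous_const (y := z)); fun_prop)
      have e4 : ∫ y, D y y⁻¹ * D x z ∂μ = D x z - ∫ y, f y * f y⁻¹ * D x z ∂μ := by
        have : ∀ y, D y y⁻¹ * D x z = D x z - f y * f y⁻¹ * D x z := fun y => by
          rw [hD y, mul_inv_cancel, h.map_one, sub_mul, hqD]
        simp_rw [this]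
        rw [integral_sub (integrable_const _) i1]
        simp
      have e5 : ∫ y, D x y * D y⁻¹ z ∂μ =
          (∫ y, f (x * y) * D y⁻¹ z ∂μ) - ∫ y, f x * (f y * D y⁻¹ z) ∂μ := by
        rw [← integral_sub i3 i4]
        congr 1; ext y
        rw [hD x y, sub_mul, mul_assoc]
      rw [e4, e5, e1, e2]
      simp_rw [coc]
      rw [integral_sub (f := fun y => f y * D y⁻¹ (x * z) + f y * f y⁻¹ * D x z)
        ((hcint _).add i1) i2, integral_add (hcint _) i1, e3, ← hc]
      abel
    have hb : ∀ a b : B, ‖a‖ ≤ η → ‖b‖ ≤ η → ‖a * b‖ ≤ η ^ 2 := fun a b ha hb =>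
      (norm_mul_le _ _).trans (by rw [sq]; exact mul_le_mul ha hb (norm_nonneg _) hη)
    rw [← hD, key, two_mul]
    exact (norm_add_le _ _).trans (add_le_add (hbd _ _ fun y => hb _ _ (hDb _ _) (hDb _ _))
      (hbd _ _ fun y => hb _ _ (hDb _ _) (hDb _ _)))

/-- One Newton step: the defect of an approximate representation can be made quadratically
smaller. -/
theorem exists_improved [IsTopologicalGroup G] [CompactSpace G]
    [SecondCountableTopology G] (h : IsApproxRep q η f) (hf : ∀ x, ‖f x‖ ≤ 2) :
    ∃ f' : G → B, IsApproxRep q (6 * η ^ 2) f' ∧ ∀ x, ‖f' x - f x‖ ≤ 2 * η := by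
  obtain ⟨c, hc, hc1, hqc, hcq, hcb, hcd⟩ := h.exists_correction hf
  have hη : 0 ≤ η := (norm_nonneg _).trans (h.defect 1 1)
  let k : G → B := fun x => (1 / 2 : ℝ) • (c x + star (c x⁻¹))
  have hk : ∀ x, ‖k x‖ ≤ 2 * η := fun x => by
    rw [norm_smul]
    have := norm_add_le (c x) (star (c x⁻¹))
    rw [norm_star] at this
    have h1 := hcb x
    have h2 := hcb x⁻¹
    norm_num
    linarith
  have hkd : ∀ x z, ‖f (x * z) - f x * f z + k (x * z) - f x * k z - k x * f z‖ ≤ 2 * η ^ 2 := by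
    intro x z
    have e : f (x * z) - f x * f z + k (x * z) - f x * k z - k x * f z =
        (1 / 2 : ℝ) • ((f (x * z) - f x * f z + c (x * z) - f x * c z - c x * f z) +
          star (f (z⁻¹ * x⁻¹) - f z⁻¹ * f x⁻¹ + c (z⁻¹ * x⁻¹) - f z⁻¹ * c x⁻¹
            - c z⁻¹ * f x⁻¹)) := by
      have e0 : star (f (z⁻¹ * x⁻¹)) = f (x * z) := by rw [← h.map_inv]; simp
      have e1 : ∀ y, star (f y⁻¹) = f y := fun y => by rw [← h.map_inv, inv_inv]
      simp only [k, star_add, star_sub, star_mul, e0, e1, mul_inv_rev, mul_smul_comm,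
        smul_mul_assoc, mul_add, add_mul]
      module
    rw [e, norm_smul]
    have := norm_add_le (f (x * z) - f x * f z + c (x * z) - f x * c z - c x * f z)
      (star (f (z⁻¹ * x⁻¹) - f z⁻¹ * f x⁻¹ + c (z⁻¹ * x⁻¹) - f z⁻¹ * c x⁻¹ - c z⁻¹ * f x⁻¹))
    rw [norm_star] at this
    have h1 := hcd x z
    have h2 := hcd z⁻¹ x⁻¹
    rw [show ‖(1 / 2 : ℝ)‖ = 1 / 2 by norm_num]
    linarith
  refine ⟨fun x => f x + k x, ⟨?_, ?_, ?_, ?_, ?_⟩, fun x => by simpa using hk x⟩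
  · have := h.continuous
    fun_prop
  · simp [k, hc1, h.map_one]
  · intro x
    have : q * star (c x⁻¹) = star (c x⁻¹) := by
      conv_rhs => rw [← hcq x⁻¹, star_mul, h.star_eq]
    simp only [k, mul_add, mul_smul_comm, h.mul_left, hqc, this]
  · intro x
    simp only [k, star_add, star_smul, star_star, inv_inv, h.map_inv, star_trivial]
    rw [add_comm (c x⁻¹)]
  · intro x z
    have e : f (x * z) + k (x * z) - (f x + k x) * (f z + k z) =
        (f (x * z) - f x * f z + k (x * z) - f x * k z - k x * f z) - k x * k z := by
      rw [add_mul, mul_add, mul_add]; abel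
    rw [e]
    have h1 := norm_sub_le (f (x * z) - f x * f z + k (x * z) - f x * k z - k x * f z) (k x * k z)
    have h2 := hkd x z
    have h3 : ‖k x * k z‖ ≤ (2 * η) * (2 * η) :=
      (norm_mul_le _ _).trans (mul_le_mul (hk x) (hk z) (norm_nonneg _) (by positivity))
    nlinarith

/-- An approximate representation of a compact group is close to a genuine one. -/
theorem exists_rep [IsTopologicalGroup G] [CompactSpace G]
    [SecondCountableTopology G] (h : IsApproxRep q η f) (hη : η ≤ 1 / 12) (hf : ∀ x, ‖f x‖ + 4 * η ≤ 2) :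
    ∃ ρ : G → B, IsApproxRep q 0 ρ ∧ ∀ x, ‖ρ x - f x‖ ≤ 4 * η := by
  have hη0 : 0 ≤ η := (norm_nonneg _).trans (h.defect 1 1)
  let δ : ℕ → ℝ := fun n => η / 2 ^ n
  let S := {p : ℕ × (G → B) // IsApproxRep q (δ p.1) p.2 ∧
    ∀ x, ‖p.2 x‖ + 4 * δ p.1 ≤ 2}
  have hδ0 : ∀ n, 0 ≤ δ n := fun n => by positivity
  have hδ : ∀ n, δ (n + 1) = δ n / 2 := fun n => by simp only [δ, pow_succ]; field_simp
  have hδ1 : ∀ n, δ n ≤ 1 / 12 := fun n =>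
    (div_le_self hη0 (one_le_pow₀ (by norm_num))).trans hη
  have step : ∀ p : S, ∃ p' : S, p'.1.1 = p.1.1 + 1 ∧
      ∀ x, ‖p'.1.2 x - p.1.2 x‖ ≤ 2 * δ p.1.1 := by
    rintro ⟨⟨n, g⟩, hg, hb⟩
    simp only at hg hb
    obtain ⟨g', hg', hd⟩ := hg.exists_improved fun x => by linarith [hb x, hδ0 n]
    refine ⟨⟨⟨n + 1, g'⟩, ?_, ?_⟩, rfl, hd⟩
    · refine ⟨hg'.1, hg'.2, hg'.3, hg'.4, fun x y => (hg'.5 x y).trans ?_⟩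
      simp only [hδ]
      nlinarith [hδ0 n, hδ1 n]
    · intro x
      have h1 := hd x
      have h2 := norm_sub_norm_le (g' x) (g x)
      have h3 := hb x
      simp only [hδ]
      linarith
  choose next hnext1 hnext2 using step
  let s0 : S := ⟨⟨0, f⟩, by
    refine ⟨?_, ?_⟩
    · simpa [δ] using h
    · simpa [δ] using hf⟩
  let s : ℕ → S := fun n => next^[n] s0
  have hs : ∀ n, s (n + 1) = next (s n) := fun n => Function.iterate_succ_apply' _ _ _
  have hs1 : ∀ n, (s n).1.1 = n := fun n => by
    induction n with
    | zero => rfl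
    | succ k ih => rw [hs, hnext1, ih]
  let F : ℕ → G → B := fun n => (s n).1.2
  have hF0 : F 0 = f := rfl
  have hF : ∀ n, IsApproxRep q (δ n) (F n) := fun n => by
    have := (s n).2.1
    rwa [hs1] at this
  have hFd : ∀ x n, dist (F n x) (F (n + 1) x) ≤ (4 * η) / 2 / 2 ^ n := fun x n => by
    have := hnext2 (s n) x
    rw [hs1] at this
    rw [dist_comm, dist_eq_norm]
    simp only [F, hs]
    refine this.trans (le_of_eq ?_)
    simp only [δ]; ring
  have hcau : ∀ x, CauchySeq fun n => F n x := fun x => cauchySeq_of_le_geometric_two (hFd x)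
  choose ρ hρ using fun x => cauchySeq_tendsto_of_complete (hcau x)
  have hdist : ∀ x n, dist (F n x) (ρ x) ≤ 4 * η / 2 ^ n := fun x n =>
    dist_le_of_le_geometric_two_of_tendsto (hFd x) (hρ x) n
  have hδlim : Tendsto (fun n : ℕ => 4 * η / 2 ^ n) atTop (𝓝 0) := by
    have := (tendsto_pow_atTop_nhds_zero_of_lt_one (r := (1 / 2 : ℝ)) (by norm_num)
      (by norm_num)).const_mul (4 * η)
    simpa [div_eq_mul_inv] using this
  have hunif : TendstoUniformly F ρ atTop := by
    rw [Metric.tendstoUniformly_iff]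
    intro r hr
    filter_upwards [hδlim.eventually (gt_mem_nhds hr)] with n hn x
    rw [dist_comm]
    exact (hdist x n).trans_lt hn
  refine ⟨ρ, ⟨hunif.continuous (Eventually.frequently (Eventually.of_forall fun n =>
    (hF n).continuous)), ?_, ?_, ?_, ?_⟩, ?_⟩
  · refine tendsto_nhds_unique (hρ 1) ?_
    simp only [(hF _).map_one, tendsto_const_nhds_iff]
  · intro x
    refine tendsto_nhds_unique ((hρ x).const_mul q) ?_
    simpa only [(hF _).mul_left] using hρ x
  · intro x
    refine tendsto_nhds_unique (hρ x⁻¹) ?_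
    simpa only [(hF _).map_inv] using (hρ x).star
  · intro x y
    have h1 := ((hρ (x * y)).sub ((hρ x).mul (hρ y))).norm
    refine le_of_tendsto_of_tendsto h1 hδlim (Eventually.of_forall fun n => ?_)
    refine ((hF n).defect x y).trans ?_
    simp only [δ]
    gcongr
    linarith
  · intro x
    have := hdist x 0
    rw [dist_comm, dist_eq_norm, hF0] at this
    simpa using this

end IsApproxRep

end ApproxRep

section Projections

theorem eq_of_norm_sub_le_pow {E : Type*} [NormedAddCommGroup E] {x y : E} {C r : ℝ}
    (hr0 : 0 ≤ r) (hr : r < 1) (h : ∀ n : ℕ, ‖x - y‖ ≤ C * r ^ n) : x = y := by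
  have h1 := (tendsto_pow_atTop_nhds_zero_of_lt_one hr0 hr).const_mul C
  rw [mul_zero] at h1
  exact sub_eq_zero.1 (norm_le_zero_iff.1 (ge_of_tendsto' h1 h))

/-- A multiplicative map which stays within distance `1 / 2` of a unit `q` is constant. -/
theorem eq_of_forall_norm_sub_le_half {M R : Type*} [Monoid M] [NonUnitalNormedRing R]
    [NormedSpace ℝ R] {q : R} (hq : q * q = q) {w : M → R} (hmul : ∀ x y, w (x * y) = w x * w y)
    (hl : ∀ x, q * w x = w x) (hr : ∀ x, w x * q = w x) (hw : ∀ x, ‖w x - q‖ ≤ 1 / 2) (x : M) :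
    w x = q := by
  have key : ∀ n : ℕ, ∀ x, ‖w x - q‖ ≤ 1 / 2 * (2 / 3) ^ n := by
    intro n
    induction n with
    | zero => simpa using hw
    | succ n ih =>
      intro x
      have e : (2 : ℝ) • (w x - q) = (w (x * x) - q) - (w x - q) * (w x - q) := by
        rw [hmul, sub_mul, mul_sub, mul_sub, hl, hr, hq, two_smul]
        abel
      have h1 := norm_sub_le (w (x * x) - q) ((w x - q) * (w x - q))
      have h2 := norm_mul_le (w x - q) (w x - q)
      have h3 := ih (x * x)
      have h4 := hw x
      rw [← e, norm_smul, Real.norm_of_nonneg zero_le_two] at h1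
      rw [pow_succ]
      nlinarith [norm_nonneg (w x - q)]
  exact eq_of_norm_sub_le_pow (by norm_num) (by norm_num) fun n => key n x

theorem IsIdempotentElem.eq_zero_of_norm_lt_one {R : Type*} [NonUnitalNormedRing R] {e : R}
    (he : IsIdempotentElem e) (h : ‖e‖ < 1) : e = 0 := by
  have h1 := norm_mul_le e e
  rw [he.eq] at h1
  by_contra h0
  nlinarith [norm_pos_iff.2 h0]

theorem IsStarProjection.norm_le_one {R : Type*} [NonUnitalNormedRing R] [StarRing R] [CStarRing R]
    {e : R} (he : IsStarProjection e) : ‖e‖ ≤ 1 := by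
  have h1 := CStarRing.norm_star_mul_self (x := e)
  rw [he.isSelfAdjoint.star_eq, he.isIdempotentElem.eq] at h1
  by_contra! h0
  nlinarith

end Projections

section Spectral

variable {A : Type*} [CStarAlgebra A] [FiniteDimensional ℂ A]

theorem spectrum.finite_of_finiteDimensional (a : A) : (spectrum ℂ a).Finite := by
  refine (Module.End.finite_spectrum (Algebra.lmul ℂ A a)).subset fun z hz => ?_
  rw [spectrum.mem_iff] at hz ⊢
  rwa [← (Algebra.lmul ℂ A).commutes, ← map_sub, Algebra.lmul_isUnit_iff]

/-- Spectral decomposition of a normal element of a finite-dimensional C*-algebra. -/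
theorem exists_spectral_decomposition (a : A) (ha : IsStarNormal a) :
    ∃ (s : Finset ℂ) (p : ℂ → A), (∀ i, IsStarProjection (p i)) ∧
      (∀ i j, i ≠ j → p i * p j = 0) ∧ ∑ i ∈ s, p i = 1 ∧ ∑ i ∈ s, i • p i = a ∧
      ∀ i ∈ s, i ∈ spectrum ℂ a := by
  have hfin := spectrum.finite_of_finiteDimensional a
  have hcont : ∀ f : ℂ → ℂ, ContinuousOn f (spectrum ℂ a) := fun f => hfin.continuousOn f
  let e : ℂ → ℂ → ℂ := fun i z => if z = i then 1 else 0
  refine ⟨hfin.toFinset, fun i => cfc (e i) a, ?_, ?_, ?_, ?_, ?_⟩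
  · intro i
    constructor
    · rw [IsIdempotentElem, ← cfc_mul _ _ _ (hcont _) (hcont _)]
      congr 1; ext z; simp [e]
    · rw [IsSelfAdjoint, ← cfc_star]
      congr 1; ext z; simp only [e]; split_ifs <;> simp
  · intro i j hij
    rw [← cfc_mul _ _ _ (hcont _) (hcont _)]
    have : (fun z => e i z * e j z) = 0 := by
      ext z; simp only [e, Pi.zero_apply]; split_ifs <;> simp_all
    rw [this, cfc_zero]
  · rw [← cfc_sum _ _ _ fun i _ => hcont _, ← cfc_one ℂ a]
    refine cfc_congr fun z hz => ?_
    simp [e, hz]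
  · have : ∀ i, i • cfc (e i) a = cfc (fun z => i * e i z) a := fun i =>
      (cfc_const_mul _ _ _ (hcont _)).symm
    simp_rw [this]
    rw [← cfc_sum _ _ _ fun i _ => hcont _]
    conv_rhs => rw [← cfc_id ℂ a]
    refine cfc_congr fun z hz => ?_
    simp [e]
    intro h; exact absurd hz h
  · simp

end Spectral

section ProjUnitary

theorem norm_coe_unitary_le_one {A : Type*} [NormedRing A] [StarRing A] [CStarRing A]
    (u : unitary A) : ‖(u : A)‖ ≤ 1 := by
  cases subsingleton_or_nontrivial A with
  | inl _ => rw [Subsingleton.elim (u : A) 0, norm_zero]; exact zero_le_one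
  | inr _ => exact (CStarRing.norm_coe_unitary _).le

variable {A : Type*} [CStarAlgebra A]

/-- The unitary `1 - p + z p` attached to a projection `p` and a point `z` of the circle. -/
noncomputable def projUnitary {p : A} (hp : IsStarProjection p) (z : Circle) : unitary A :=
  have hmul : ∀ z w : Circle, (1 - p + (z : ℂ) • p) * (1 - p + (w : ℂ) • p) =
      1 - p + ((z * w : Circle) : ℂ) • p := fun z w => by
    simp only [mul_add, add_mul, mul_sub, sub_mul, mul_smul_comm, smul_mul_assoc,
      hp.isIdempotentElem.eq, one_mul, mul_one, Circle.coe_mul]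
    module
  have hstar : star (1 - p + (z : ℂ) • p) = 1 - p + ((z⁻¹ : Circle) : ℂ) • p := by
    simp [hp.isSelfAdjoint.star_eq, -Circle.coe_inv, Circle.coe_inv_eq_conj]
  ⟨1 - p + (z : ℂ) • p, by
    rw [Unitary.mem_iff, hstar, hmul, hmul]
    simp⟩

theorem coe_projUnitary {p : A} (hp : IsStarProjection p) (z : Circle) :
    (projUnitary hp z : A) = 1 - p + (z : ℂ) • p := rfl

theorem projUnitary_mul {p : A} (hp : IsStarProjection p) (z w : Circle) :
    projUnitary hp (z * w) = projUnitary hp z * projUnitary hp w := by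
  ext
  simp only [Submonoid.coe_mul, coe_projUnitary, mul_add, add_mul, mul_sub, sub_mul,
    mul_smul_comm, smul_mul_assoc, hp.isIdempotentElem.eq, one_mul, mul_one, Circle.coe_mul]
  module

theorem projUnitary_one {p : A} (hp : IsStarProjection p) : projUnitary hp 1 = 1 := by
  ext; simp [coe_projUnitary]

theorem projUnitary_inv {p : A} (hp : IsStarProjection p) (z : Circle) :
    projUnitary hp z⁻¹ = (projUnitary hp z)⁻¹ :=
  eq_inv_of_mul_eq_one_left (by rw [← projUnitary_mul, inv_mul_cancel, projUnitary_one])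

theorem projUnitary_comm {p p' : A} (hp : IsStarProjection p) (hp' : IsStarProjection p')
    (h : p * p' = 0) (z w : Circle) :
    projUnitary hp z * projUnitary hp' w = projUnitary hp' w * projUnitary hp z := by
  have h' : p' * p = 0 := by
    simpa [hp.isSelfAdjoint.star_eq, hp'.isSelfAdjoint.star_eq] using congrArg star h
  ext
  simp only [Submonoid.coe_mul, coe_projUnitary, mul_add, add_mul, mul_sub, sub_mul,
    mul_smul_comm, smul_mul_assoc, h, h', one_mul, mul_one]
  module

end ProjUnitary

section NearRep

variable {A B : Type*} [CStarAlgebra A] [NonUnitalCStarAlgebra B]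

/-- An exact representation `ρ` of the unitary group, with `q = ρ 1`, which is close to an
approximate `*`-homomorphism `φ`. -/
structure IsNearRep (q : B) (ρ : unitary A → B) (ε δ : ℝ) (φ : A → B) : Prop where
  rep : IsApproxRep q 0 ρ
  hom : EpsStarHom ε φ
  near : ∀ u : unitary A, ‖ρ u - φ u‖ ≤ δ
  eps_le : ε ≤ 1 / 100
  delta_le : δ ≤ 1 / 100

/-- The projection of `B` associated by `ρ` to a projection `p` of `A`. -/
noncomputable def repProj (ρ : unitary A → B) {p : A} (hp : IsStarProjection p) : B :=
  (1 / 2 : ℂ) • (ρ 1 - ρ (projUnitary hp (-1)))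

theorem EpsStarHom.norm_sub_lt {A B : Type*} [NonUnitalCStarAlgebra A] [NonUnitalCStarAlgebra B]
    {ε : ℝ} {φ : A → B} (h : EpsStarHom ε φ) {x y : A} (hx : ‖x‖ ≤ 1) (hy : ‖y‖ ≤ 1) :
    ‖φ (x - y) - (φ x - φ y)‖ < ε := by
  have := h.2.1 x y hx hy 1 (-1) (by simp) (by simp)
  simpa [sub_eq_add_neg] using this

theorem EpsStarHom.norm_zero_lt {A B : Type*} [NonUnitalCStarAlgebra A] [NonUnitalCStarAlgebra B]
    {ε : ℝ} {φ : A → B} (h : EpsStarHom ε φ) : ‖φ 0‖ < ε := by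
  have := h.2.1 0 0 (by simp) (by simp) 0 0 (by simp) (by simp)
  simpa using this

namespace IsNearRep

variable {q : B} {ρ : unitary A → B} {ε δ : ℝ} {φ : A → B}

theorem map_mul (h : IsNearRep q ρ ε δ φ) (u v : unitary A) : ρ (u * v) = ρ u * ρ v := by
  have := h.rep.defect u v
  rwa [norm_le_zero_iff, sub_eq_zero] at this

theorem isStarProjection (h : IsNearRep q ρ ε δ φ) : IsStarProjection q where
  isIdempotentElem := by
    have := h.rep.mul_left 1
    rwa [h.rep.map_one] at this
  isSelfAdjoint := h.rep.star_eq

section Proj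

variable {p p' : A} (hp : IsStarProjection p) (hp' : IsStarProjection p')

theorem mul_repProj (h : IsNearRep q ρ ε δ φ) : q * repProj ρ hp = repProj ρ hp := by
  simp only [repProj, mul_smul_comm, mul_sub, h.rep.mul_left]

theorem repProj_mul (h : IsNearRep q ρ ε δ φ) : repProj ρ hp * q = repProj ρ hp := by
  simp only [repProj, smul_mul_assoc, sub_mul, h.rep.mul_right]

theorem repProj_isStarProjection (h : IsNearRep q ρ ε δ φ) :
    IsStarProjection (repProj ρ hp) where
  isIdempotentElem := by
    have h1 : ρ (projUnitary hp (-1)) * ρ (projUnitary hp (-1)) = q := by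
      rw [← h.map_mul, ← projUnitary_mul, ← h.rep.map_one]
      simp [projUnitary_one]
    rw [IsIdempotentElem, repProj]
    simp only [smul_mul_assoc, mul_smul_comm, mul_sub, sub_mul, h1, h.rep.map_one,
      h.rep.mul_right, h.rep.mul_left, h.isStarProjection.isIdempotentElem.eq]
    module
  isSelfAdjoint := by
    have h1 : star (ρ (projUnitary hp (-1))) = ρ (projUnitary hp (-1)) := by
      rw [← h.rep.map_inv, ← projUnitary_inv]
      simp
    rw [IsSelfAdjoint, repProj]
    simp [h1, h.rep.map_one, h.isStarProjection.isSelfAdjoint.star_eq]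

theorem norm_sub_projUnitary_le (h : IsNearRep q ρ ε δ φ) (z : Circle) :
    ‖ρ (projUnitary hp z) - (φ 1 - φ p + (z : ℂ) • φ p)‖ ≤ δ + 2 * ε := by
  have n1 : ‖(1 : A)‖ ≤ 1 := (IsStarProjection.one A).norm_le_one
  have h1 := h.near (projUnitary hp z)
  have h2 := h.hom.2.1 (1 - p) p hp.one_sub.norm_le_one hp.norm_le_one 1 (z : ℂ)
    (by simp) (Circle.norm_coe z).le
  have h3 := h.hom.norm_sub_lt n1 hp.norm_le_one
  rw [one_smul, one_smul, ← coe_projUnitary hp] at h2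
  have e : ρ (projUnitary hp z) - (φ 1 - φ p + (z : ℂ) • φ p) =
      (ρ (projUnitary hp z) - φ (projUnitary hp z)) +
      (φ (projUnitary hp z) - (φ (1 - p) + (z : ℂ) • φ p)) + (φ (1 - p) - (φ 1 - φ p)) := by abel
  rw [e]
  refine (norm_add₃_le).trans ?_
  linarith

theorem norm_repProj_sub_le (h : IsNearRep q ρ ε δ φ) : ‖repProj ρ hp - φ p‖ ≤ δ + ε := by
  have h1 := h.near 1
  have h2 := h.norm_sub_projUnitary_le hp (-1)
  have e : repProj ρ hp - φ p = (1 / 2 : ℝ) • ((ρ 1 - φ 1) -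
      (ρ (projUnitary hp (-1)) - (φ 1 - φ p + ((-1 : Circle) : ℂ) • φ p))) := by
    rw [repProj]
    simp
    module
  rw [e, norm_smul]
  have := norm_sub_le (ρ 1 - φ 1)
    (ρ (projUnitary hp (-1)) - (φ 1 - φ p + ((-1 : Circle) : ℂ) • φ p))
  rw [show ‖(1 / 2 : ℝ)‖ = 1 / 2 by norm_num]
  simp only [OneMemClass.coe_one] at h1
  linarith

theorem map_projUnitary (h : IsNearRep q ρ ε δ φ) (z : Circle) :
    ρ (projUnitary hp z) = q - repProj ρ hp + (z : ℂ) • repProj ρ hp := by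
  set P := repProj ρ hp with hP
  have hPP : P * P = P := (h.repProj_isStarProjection hp).isIdempotentElem.eq
  have hqP : q * P = P := h.mul_repProj hp
  have hPq : P * q = P := h.repProj_mul hp
  have hqq : q * q = q := h.isStarProjection.isIdempotentElem.eq
  have hcomm : ∀ z, ρ (projUnitary hp z) * P = P * ρ (projUnitary hp z) := fun z => by
    have : ρ (projUnitary hp z) * ρ (projUnitary hp (-1)) =
        ρ (projUnitary hp (-1)) * ρ (projUnitary hp z) := by
      rw [← h.map_mul, ← h.map_mul, ← projUnitary_mul, ← projUnitary_mul, mul_comm]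
    rw [hP, repProj]
    simp only [mul_smul_comm, smul_mul_assoc, mul_sub, sub_mul, this, h.rep.map_one,
      h.rep.mul_left, h.rep.mul_right]
  let t : Circle → B := fun z => q - P + (z : ℂ) • P
  have ht : ∀ z w, t z * t w = t (z * w) := fun z w => by
    simp only [t, mul_add, add_mul, mul_sub, sub_mul, mul_smul_comm, smul_mul_assoc, hPP, hqP,
      hPq, hqq, Circle.coe_mul]
    module
  have ht1 : t 1 = q := by simp [t]
  have hqt : ∀ z, q * t z = t z := fun z => by rw [← ht1, ht, one_mul]
  have htq : ∀ z, t z * q = t z := fun z => by rw [← ht1, ht, mul_one]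
  have htc : ∀ z w, t z * ρ (projUnitary hp w) = ρ (projUnitary hp w) * t z := fun z w => by
    simp only [t, mul_add, add_mul, mul_sub, sub_mul, mul_smul_comm, smul_mul_assoc, hcomm,
      h.rep.mul_left, h.rep.mul_right]
  have hclose : ∀ z, ‖ρ (projUnitary hp z) - t z‖ ≤ 1 / 10 := fun z => by
    have h1 := h.norm_sub_projUnitary_le hp z
    have h2 := h.norm_repProj_sub_le hp
    have h3 := h.near 1
    simp only [OneMemClass.coe_one, h.rep.map_one] at h3
    have e : ρ (projUnitary hp z) - t z = (ρ (projUnitary hp z) - (φ 1 - φ p + (z : ℂ) • φ p))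
        - (q - φ 1) + ((P - φ p) - (z : ℂ) • (P - φ p)) := by
      simp only [t]; module
    rw [e]
    have n1 := norm_add_le ((ρ (projUnitary hp z) - (φ 1 - φ p + (z : ℂ) • φ p)) - (q - φ 1))
      ((P - φ p) - (z : ℂ) • (P - φ p))
    have n2 := norm_sub_le (ρ (projUnitary hp z) - (φ 1 - φ p + (z : ℂ) • φ p)) (q - φ 1)
    have n3 := norm_sub_le (P - φ p) ((z : ℂ) • (P - φ p))
    rw [norm_smul, Circle.norm_coe, one_mul] at n3
    linarith [h.eps_le, h.delta_le]
  have htn : ∀ z, ‖t z‖ ≤ 3 := fun z => by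
    have n1 := norm_add_le (q - P) ((z : ℂ) • P)
    have n2 := norm_sub_le q P
    have n3 := (h.repProj_isStarProjection hp).norm_le_one
    have n4 := h.isStarProjection.norm_le_one
    rw [norm_smul, Circle.norm_coe, one_mul] at n1
    simp only [t]
    linarith
  have key := eq_of_forall_norm_sub_le_half hqq
    (w := fun z => ρ (projUnitary hp z) * t z⁻¹)
    (fun x y => by
      simp only [projUnitary_mul, h.map_mul, mul_inv]
      rw [← ht, mul_assoc, mul_assoc, ← mul_assoc _ (t x⁻¹), ← htc, mul_assoc])
    (fun x => by simp only [← mul_assoc, h.rep.mul_left])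
    (fun x => by simp only [mul_assoc, htq])
    (fun x => by
      have e : ρ (projUnitary hp x) * t x⁻¹ - q = (ρ (projUnitary hp x) - t x) * t x⁻¹ := by
        rw [sub_mul, ht, mul_inv_cancel, ht1]
      simp only [e]
      refine (norm_mul_le _ _).trans ?_
      nlinarith [hclose x, htn x⁻¹, norm_nonneg (t x⁻¹), norm_nonneg (ρ (projUnitary hp x) - t x)])
    z
  have := congrArg (· * t z) key
  simpa only [mul_assoc, ht, inv_mul_cancel, ht1, hqt, h.rep.mul_right] using this

theorem repProj_mul_repProj (h : IsNearRep q ρ ε δ φ) (hpp : p * p' = 0) :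
    repProj ρ hp * repProj ρ hp' = 0 := by
  set P := repProj ρ hp with hP
  set P' := repProj ρ hp' with hP'
  have hPi := h.repProj_isStarProjection hp
  have hPi' := h.repProj_isStarProjection hp'
  have hc : Commute P P' := by
    have : ρ (projUnitary hp (-1)) * ρ (projUnitary hp' (-1)) =
        ρ (projUnitary hp' (-1)) * ρ (projUnitary hp (-1)) := by
      rw [← h.map_mul, ← h.map_mul, projUnitary_comm hp hp' hpp]
    rw [Commute, SemiconjBy, hP, hP', repProj, repProj]
    simp only [mul_smul_comm, smul_mul_assoc, mul_sub, sub_mul, this, h.rep.map_one,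
      h.rep.mul_left, h.rep.mul_right]
    module
  refine IsIdempotentElem.eq_zero_of_norm_lt_one
    (hPi.isIdempotentElem.mul_of_commute hc hPi'.isIdempotentElem) ?_
  have h1 := h.norm_repProj_sub_le hp
  have h2 := h.norm_repProj_sub_le hp'
  have h3 := h.hom.2.2.2 p p' hp.norm_le_one hp'.norm_le_one
  have h4 := h.hom.norm_zero_lt
  have h5 := h.hom.1 p hp.norm_le_one
  rw [hpp] at h3
  have e : P * P' = (P - φ p) * P' + φ p * (P' - φ p') - (φ 0 - φ p * φ p') + φ 0 := by
    rw [sub_mul, mul_sub]; abel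
  rw [e]
  have n1 := norm_add_le ((P - φ p) * P' + φ p * (P' - φ p') - (φ 0 - φ p * φ p')) (φ 0)
  have n2 := norm_sub_le ((P - φ p) * P' + φ p * (P' - φ p')) (φ 0 - φ p * φ p')
  have n3 := norm_add_le ((P - φ p) * P') (φ p * (P' - φ p'))
  have n4 := norm_mul_le (P - φ p) P'
  have n5 := norm_mul_le (φ p) (P' - φ p')
  have n6 := hPi'.norm_le_one
  have n7 : ‖P - φ p‖ * ‖P'‖ ≤ ‖P - φ p‖ := mul_le_of_le_one_right (norm_nonneg _) n6
  have n8 : ‖φ p‖ * ‖P' - φ p'‖ ≤ ‖P' - φ p'‖ := mul_le_of_le_one_left (norm_nonneg _) h5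
  linarith [h.eps_le, h.delta_le]

theorem repProj_one (h : IsNearRep q ρ ε δ φ) : repProj ρ (IsStarProjection.one A) = q := by
  set P := repProj ρ (IsStarProjection.one A) with hP
  have hid : IsIdempotentElem (q - P) := by
    rw [IsIdempotentElem]
    simp only [mul_sub, sub_mul, hP, h.mul_repProj, h.repProj_mul,
      (h.repProj_isStarProjection _).isIdempotentElem.eq, h.isStarProjection.isIdempotentElem.eq]
    abel
  refine (sub_eq_zero.1 (hid.eq_zero_of_norm_lt_one ?_)).symm
  have h2 := h.norm_repProj_sub_le (IsStarProjection.one A)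
  have h3 := h.near 1
  simp only [OneMemClass.coe_one, h.rep.map_one] at h3
  have n := norm_sub_le (q - φ 1) (P - φ 1)
  rw [sub_sub_sub_cancel_right] at n
  linarith [h.eps_le, h.delta_le]

end Proj

section Family

variable {ι : Type*} {p : ι → A}

theorem exists_map_sum (h : IsNearRep q ρ ε δ φ) (hp : ∀ i, IsStarProjection (p i))
    (hpp : ∀ i j, i ≠ j → p i * p j = 0) (s : Finset ι) (z : ι → Circle) :
    ∃ u : unitary A, (u : A) = 1 + ∑ i ∈ s, ((z i : ℂ) - 1) • p i ∧
      ρ u = q + ∑ i ∈ s, ((z i : ℂ) - 1) • repProj ρ (hp i) := by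
  classical
  induction s using Finset.induction_on with
  | empty => exact ⟨1, by simp, by simp [h.rep.map_one]⟩
  | insert j s hj ih =>
    obtain ⟨u, hu, hρu⟩ := ih
    have hsj : ∀ i ∈ s, i ≠ j := fun i hi e => hj (e ▸ hi)
    refine ⟨u * projUnitary (hp j) (z j), ?_, ?_⟩
    · have e : (∑ i ∈ s, ((z i : ℂ) - 1) • p i) * p j = 0 := by
        rw [Finset.sum_mul]
        exact Finset.sum_eq_zero fun i hi => by rw [smul_mul_assoc, hpp i j (hsj i hi), smul_zero]
      rw [Finset.sum_insert hj, Submonoid.coe_mul, hu, coe_projUnitary]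
      simp only [mul_add, mul_sub, mul_one, mul_smul_comm, add_mul, e, one_mul]
      module
    · have e : (∑ i ∈ s, ((z i : ℂ) - 1) • repProj ρ (hp i)) * repProj ρ (hp j) = 0 := by
        rw [Finset.sum_mul]
        exact Finset.sum_eq_zero fun i hi => by
          rw [smul_mul_assoc, h.repProj_mul_repProj (hp i) (hp j) (hpp i j (hsj i hi)), smul_zero]
      have e' : (∑ i ∈ s, ((z i : ℂ) - 1) • repProj ρ (hp i)) * q =
          ∑ i ∈ s, ((z i : ℂ) - 1) • repProj ρ (hp i) := by
        rw [Finset.sum_mul]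
        simp only [smul_mul_assoc, h.repProj_mul]
      rw [Finset.sum_insert hj, h.map_mul, hρu, h.map_projUnitary]
      simp only [mul_add, mul_sub, mul_smul_comm, add_mul, e, e', h.mul_repProj,
        h.isStarProjection.isIdempotentElem.eq]
      module

theorem sum_repProj (h : IsNearRep q ρ ε δ φ) (hp : ∀ i, IsStarProjection (p i))
    (hpp : ∀ i j, i ≠ j → p i * p j = 0) {s : Finset ι} (hs : ∑ i ∈ s, p i = 1) :
    ∑ i ∈ s, repProj ρ (hp i) = q := by
  obtain ⟨u, hu, hρu⟩ := h.exists_map_sum hp hpp s fun _ => -1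
  have : u = projUnitary (IsStarProjection.one A) (-1) := by
    ext
    rw [hu, coe_projUnitary, ← Finset.smul_sum, hs]
    simp
    module
  rw [this, h.map_projUnitary, h.repProj_one, ← Finset.smul_sum] at hρu
  have e : q - q + ((-1 : Circle) : ℂ) • q = q + (((-1 : Circle) : ℂ) - 1) • q := by simp; module
  rw [e, add_right_inj] at hρu
  refine (smul_right_injective B (r := ((-1 : Circle) : ℂ) - 1) ?_ hρu).symm
  rw [Circle.coe_neg, Circle.coe_one]
  norm_num

theorem exists_map_eq_sum (h : IsNearRep q ρ ε δ φ) (hp : ∀ i, IsStarProjection (p i))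
    (hpp : ∀ i j, i ≠ j → p i * p j = 0) {s : Finset ι} (hs : ∑ i ∈ s, p i = 1) (z : ι → Circle) :
    ∃ u : unitary A, (u : A) = ∑ i ∈ s, (z i : ℂ) • p i ∧
      ρ u = ∑ i ∈ s, (z i : ℂ) • repProj ρ (hp i) := by
  obtain ⟨u, hu, hρu⟩ := h.exists_map_sum hp hpp s z
  refine ⟨u, ?_, ?_⟩
  · rw [hu, ← hs, ← Finset.sum_add_distrib]
    exact Finset.sum_congr rfl fun i _ => by module
  · rw [hρu, ← h.sum_repProj hp hpp hs, ← Finset.sum_add_distrib]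
    exact Finset.sum_congr rfl fun i _ => by module

theorem norm_sum_smul_repProj_le (h : IsNearRep q ρ ε δ φ) (hp : ∀ i, IsStarProjection (p i))
    (hpp : ∀ i j, i ≠ j → p i * p j = 0) (s : Finset ι) (c : ι → ℂ) {C : ℝ} (hC : 0 ≤ C)
    (hc : ∀ i ∈ s, ‖c i‖ ≤ C) : ‖∑ i ∈ s, c i • repProj ρ (hp i)‖ ≤ C := by
  classical
  let Q : s → B := fun i => repProj ρ (hp i)
  have hQ : ∀ i, star (Q i) = Q i := fun i => (h.repProj_isStarProjection _).isSelfAdjoint.star_eq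
  have hQQ : ∀ i j, Q i * Q j = if i = j then Q i else 0 := fun i j => by
    split_ifs with hij
    · rw [← hij]; exact (h.repProj_isStarProjection _).isIdempotentElem.eq
    · exact h.repProj_mul_repProj _ _ (hpp _ _ fun e => hij (Subtype.ext e))
  let T : (s → ℂ) →⋆ₙₐ[ℂ] B :=
    { toFun := fun f => ∑ i, f i • Q i
      map_smul' := fun r f => by simp [Finset.smul_sum, mul_smul]
      map_zero' := by simp
      map_add' := fun f g => by simp [add_smul, Finset.sum_add_distrib]
      map_mul' := fun f g => by
        simp [Finset.sum_mul_sum, smul_mul_assoc, mul_smul_comm, hQQ, mul_smul]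
        exact Finset.sum_congr rfl fun i _ => smul_comm _ _ _
      map_star' := fun f => by simp [hQ] }
  have hT := NonUnitalStarAlgHom.norm_apply_le T (fun i : s => c i)
  have e : ∑ i ∈ s, c i • repProj ρ (hp i) = T (fun i : s => c i) :=
    (Finset.sum_coe_sort s fun i => c i • repProj ρ (hp i)).symm
  rw [e]
  exact hT.trans ((pi_norm_le_iff_of_nonneg hC).2 fun i => hc i i.2)

end Family

end IsNearRep

end NearRep

section Generator

theorem Circle.hasDerivAt_exp_mul_zero (r : ℝ) :
    HasDerivAt (fun t : ℝ => ((Circle.exp (t * r) : Circle) : ℂ)) (Complex.I * r) 0 := by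
  have h1 : HasDerivAt (fun t : ℝ => (t : ℂ)) 1 0 := Complex.ofRealCLM.hasDerivAt
  have h2 := ((h1.mul_const ((r : ℂ) * Complex.I)).cexp)
  simp only [Complex.ofReal_zero, zero_mul, Complex.exp_zero, one_mul] at h2
  convert h2 using 1
  · ext t; rw [Circle.coe_exp]; push_cast; rw [mul_assoc]
  · ring

theorem HasDerivAt.zero_of_norm_le {E F : Type*} [NormedAddCommGroup E] [NormedSpace ℝ E]
    [NormedAddCommGroup F] [NormedSpace ℝ F] {f : ℝ → E} {g : ℝ → F} {x : ℝ}
    (hf : HasDerivAt f 0 x) (hf0 : f x = 0) (h : ∀ t, ‖g t‖ ≤ ‖f t‖) : HasDerivAt g 0 x := by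
  have hg0 : g x = 0 := norm_le_zero_iff.1 (by simpa [hf0] using h x)
  rw [hasDerivAt_iff_isLittleO] at hf ⊢
  simp only [hf0, hg0, sub_zero, smul_zero] at hf ⊢
  exact (Asymptotics.IsBigO.of_norm_le h).trans_isLittleO hf.norm_left

variable {A B : Type*} [CStarAlgebra A] [NonUnitalCStarAlgebra B]

/-- `b` generates the image under `ρ` of a one-parameter family of unitaries tangent to `I • a`. -/
structure IsGen (q : B) (ρ : unitary A → B) (a : A) (b : B) : Prop where
  mul_left : q * b = b
  mul_right : b * q = b
  exists_curve : ∃ u : ℝ → unitary A, u 0 = 1 ∧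
    HasDerivAt (fun t => (u t : A)) (Complex.I • a) 0 ∧
    HasDerivAt (fun t => ρ (u t)) (Complex.I • b) 0

namespace IsNearRep

variable {q : B} {ρ : unitary A → B} {ε δ : ℝ} {φ : A → B}

theorem norm_map_le_one (h : IsNearRep q ρ ε δ φ) (u : unitary A) : ‖ρ u‖ ≤ 1 := by
  have h1 := CStarRing.norm_star_mul_self (x := ρ u)
  rw [← h.rep.map_inv, ← h.map_mul, inv_mul_cancel, h.rep.map_one] at h1
  have := h.isStarProjection.norm_le_one
  by_contra! h0
  nlinarith

section FiniteDimensional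

variable [FiniteDimensional ℂ A]

theorem norm_sub_le_norm_coe_sub_one (h : IsNearRep q ρ ε δ φ) (u : unitary A) :
    ‖ρ u - q‖ ≤ ‖(u : A) - 1‖ := by
  cases subsingleton_or_nontrivial A with
  | inl _ =>
    rw [show u = 1 from Subtype.ext (Subsingleton.elim _ _), h.rep.map_one]
    simp
  | inr _ =>
    obtain ⟨s, p, hp, hpp, hs, ha, hsp⟩ := exists_spectral_decomposition (u : A) inferInstance
    have hcirc : ∀ i ∈ s, ‖i‖ = 1 := fun i hi =>
      mem_sphere_zero_iff_norm.1 (Unitary.spectrum_subset_circle u (hsp i hi))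
    let z : ℂ → Circle := fun i => if hi : ‖i‖ = 1 then ⟨i, mem_sphere_zero_iff_norm.2 hi⟩ else 1
    have hz : ∀ i ∈ s, (z i : ℂ) = i := fun i hi => by simp [z, hcirc i hi]
    obtain ⟨v, hv, hρv⟩ := h.exists_map_eq_sum hp hpp hs z
    have huv : u = v := by
      ext
      rw [hv, ← ha]
      exact Finset.sum_congr rfl fun i hi => by rw [hz i hi]
    rw [huv, hρv, ← h.sum_repProj hp hpp hs, ← Finset.sum_sub_distrib, ← huv]
    have e : ∀ i ∈ s, (z i : ℂ) • repProj ρ (hp i) - repProj ρ (hp i) =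
        (i - 1) • repProj ρ (hp i) := fun i hi => by rw [hz i hi]; module
    rw [Finset.sum_congr rfl e]
    refine h.norm_sum_smul_repProj_le hp hpp s _ (norm_nonneg _) fun i hi => ?_
    refine spectrum.norm_le_norm_of_mem (𝕜 := ℂ) ?_
    have := spectrum.sub_singleton_eq (u : A) (1 : ℂ)
    rw [map_one] at this
    rw [← this]
    exact Set.sub_mem_sub (hsp i hi) rfl

theorem norm_map_sub_map_le (h : IsNearRep q ρ ε δ φ) (u v : unitary A) :
    ‖ρ u - ρ v‖ ≤ ‖(u : A) - v‖ := by
  have e : ρ u - ρ v = (ρ (u * v⁻¹) - q) * ρ v := by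
    rw [sub_mul, ← h.map_mul, inv_mul_cancel_right, h.rep.mul_left]
  have e' : ((u * v⁻¹ : unitary A) : A) - 1 = ((u : A) - v) * (v⁻¹ : unitary A) := by
    rw [sub_mul, ← Submonoid.coe_mul, ← Submonoid.coe_mul, mul_inv_cancel, Submonoid.coe_one]
  rw [e]
  refine (norm_mul_le _ _).trans ((mul_le_of_le_one_right (norm_nonneg _)
    (h.norm_map_le_one v)).trans ((h.norm_sub_le_norm_coe_sub_one _).trans ?_))
  rw [e', CStarRing.norm_mul_coe_unitary]

theorem isGen_unique (h : IsNearRep q ρ ε δ φ) {a : A} {b b' : B} (hb : IsGen q ρ a b)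
    (hb' : IsGen q ρ a b') : b = b' := by
  obtain ⟨u, hu0, hu, hρu⟩ := hb.exists_curve
  obtain ⟨v, hv0, hv, hρv⟩ := hb'.exists_curve
  have h1 := hu.sub hv
  rw [sub_self] at h1
  have h2 := (hρu.sub hρv).unique
    (h1.zero_of_norm_le (by simp [hu0, hv0]) fun t => h.norm_map_sub_map_le _ _)
  rw [← smul_sub] at h2
  exact sub_eq_zero.1 ((smul_eq_zero.1 h2).resolve_left Complex.I_ne_zero)

theorem exists_isGen (h : IsNearRep q ρ ε δ φ) {a : A} (ha : IsSelfAdjoint a) :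
    ∃ b, IsGen q ρ a b := by
  obtain ⟨s, p, hp, hpp, hs, hsum, hsp⟩ := exists_spectral_decomposition a ha.isStarNormal
  have hre : ∀ i ∈ s, i = (i.re : ℂ) := fun i hi => ha.mem_spectrum_eq_re (hsp i hi)
  choose u hu hρu using fun t : ℝ =>
    h.exists_map_eq_sum hp hpp hs fun i => Circle.exp (t * i.re)
  refine ⟨∑ i ∈ s, i • repProj ρ (hp i), ?_, ?_, u, ?_, ?_, ?_⟩
  · simp only [Finset.mul_sum, mul_smul_comm, h.mul_repProj]
  · simp only [Finset.sum_mul, smul_mul_assoc, h.repProj_mul]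
  · ext; simp [hu, hs]
  · simp only [hu]
    rw [← hsum, Finset.smul_sum]
    refine HasDerivAt.fun_sum fun i hi => ?_
    convert (Circle.hasDerivAt_exp_mul_zero i.re).smul_const (p i) using 1
    rw [smul_smul, ← hre i hi]
  · simp only [hρu]
    rw [Finset.smul_sum]
    refine HasDerivAt.fun_sum fun i hi => ?_
    convert (Circle.hasDerivAt_exp_mul_zero i.re).smul_const (repProj ρ (hp i)) using 1
    rw [smul_smul, ← hre i hi]

end FiniteDimensional

theorem isGen_add (h : IsNearRep q ρ ε δ φ) {a a' : A} {b b' : B} (hb : IsGen q ρ a b)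
    (hb' : IsGen q ρ a' b') : IsGen q ρ (a + a') (b + b') := by
  obtain ⟨u, hu0, hu, hρu⟩ := hb.exists_curve
  obtain ⟨v, hv0, hv, hρv⟩ := hb'.exists_curve
  refine ⟨by rw [mul_add, hb.mul_left, hb'.mul_left], by rw [add_mul, hb.mul_right, hb'.mul_right],
    fun t => u t * v t, by simp [hu0, hv0], ?_, ?_⟩
  · have := hu.mul hv
    simp only [hu0, hv0, OneMemClass.coe_one, mul_one, one_mul, ← smul_add] at this
    exact this
  · have := ContinuousLinearMap.hasDerivAt_of_bilinear (B := ContinuousLinearMap.mul ℝ B)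
      (fun _ => hρu) (fun _ => hρv)
    simp only [ContinuousLinearMap.mul_apply', hu0, hv0, h.rep.map_one, mul_smul_comm,
      smul_mul_assoc, hb.mul_right, hb'.mul_left] at this
    simp only [h.map_mul]
    rw [smul_add, add_comm]
    exact this

theorem isGen_smul {a : A} {b : B} (hb : IsGen q ρ a b) (r : ℝ) : IsGen q ρ (r • a) (r • b) := by
  obtain ⟨u, hu0, hu, hρu⟩ := hb.exists_curve
  have h1 : HasDerivAt (fun t : ℝ => r * t) r 0 := by
    simpa using (hasDerivAt_id (0 : ℝ)).const_mul r
  refine ⟨by rw [mul_smul_comm, hb.mul_left], by rw [smul_mul_assoc, hb.mul_right],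
    fun t => u (r * t), by simp [hu0], ?_, ?_⟩
  · rw [smul_comm]
    exact HasDerivAt.scomp (g₁ := fun t => (u t : A)) 0 (by simpa using hu) h1
  · rw [smul_comm]
    exact HasDerivAt.scomp (g₁ := fun t => ρ (u t)) 0 (by simpa using hρu) h1

theorem isGen_repProj (h : IsNearRep q ρ ε δ φ) {p : A} (hp : IsStarProjection p) :
    IsGen q ρ p (repProj ρ hp) := by
  have h1 := Circle.hasDerivAt_exp_mul_zero 1
  simp only [mul_one, Complex.ofReal_one] at h1
  refine ⟨h.mul_repProj hp, h.repProj_mul hp, fun t => projUnitary hp (Circle.exp t), ?_, ?_, ?_⟩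
  · simp [projUnitary_one]
  · simp only [coe_projUnitary]
    exact (h1.smul_const p).const_add _
  · simp only [h.map_projUnitary]
    exact (h1.smul_const _).const_add _

variable [FiniteDimensional ℂ A]

/-- A representation of the unitary group close to an approximate `*`-homomorphism extends to a
`*`-homomorphism. -/
theorem exists_starHom (h : IsNearRep q ρ ε δ φ) :
    ∃ ψ : A →⋆ₙₐ[ℂ] B, ∀ u : unitary A, ψ u = ρ u := by
  choose L hL using fun a : selfAdjoint A => h.exists_isGen a.2
  have hLadd : ∀ a b, L (a + b) = L a + L b := fun a b =>
    h.isGen_unique (hL _) (by simpa using h.isGen_add (hL a) (hL b))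
  have hLsmul : ∀ (r : ℝ) a, L (r • a) = r • L a := fun r a =>
    h.isGen_unique (hL _) (by simpa using isGen_smul (hL a) r)
  have hLsub : ∀ a b, L (a - b) = L a - L b := fun a b => by
    rw [eq_sub_iff_add_eq, ← hLadd, sub_add_cancel]
  have hL0 : L 0 = 0 := by simpa using hLsmul 0 0
  let Ψ : A →ₗ[ℂ] B :=
    { toFun := fun x => L (realPart x) + Complex.I • L (imaginaryPart x)
      map_add' := fun x y => by simp only [map_add, hLadd]; module
      map_smul' := fun c x => by
        simp only [realPart_smul, imaginaryPart_smul, hLadd, hLsub, hLsmul, RingHom.id_apply,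
          ← Complex.coe_smul]
        conv_rhs => rw [← Complex.re_add_im c]
        simp only [smul_add, add_smul, smul_smul]
        have : ((c.im : ℂ) * Complex.I * Complex.I) = -(c.im : ℂ) := by
          rw [mul_assoc, Complex.I_mul_I]; ring
        rw [add_mul, this]
        module }
  have hΨp : ∀ {p : A} (hp : IsStarProjection p), Ψ p = repProj ρ hp := fun {p} hp => by
    have h1 : L (realPart p) = repProj ρ hp := by
      refine h.isGen_unique (hL _) ?_
      rw [hp.isSelfAdjoint.coe_realPart]
      exact h.isGen_repProj hp
    change L (realPart p) + Complex.I • L (imaginaryPart p) = _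
    rw [h1, hp.isSelfAdjoint.imaginaryPart, hL0, smul_zero, add_zero]
  have hΨu : ∀ u : unitary A, Ψ u = ρ u := fun u => by
    obtain ⟨s, p, hp, hpp, hs, ha, hsp⟩ := exists_spectral_decomposition (u : A) inferInstance
    have hcirc : ∀ i ∈ s, ‖i‖ = 1 := fun i hi =>
      mem_sphere_zero_iff_norm.1 (Unitary.spectrum_subset_circle u (hsp i hi))
    let z : ℂ → Circle := fun i => if hi : ‖i‖ = 1 then ⟨i, mem_sphere_zero_iff_norm.2 hi⟩ else 1
    have hz : ∀ i ∈ s, (z i : ℂ) = i := fun i hi => by simp [z, hcirc i hi]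
    obtain ⟨v, hv, hρv⟩ := h.exists_map_eq_sum hp hpp hs z
    have huv : u = v := by
      ext
      rw [hv, ← ha]
      exact Finset.sum_congr rfl fun i hi => by rw [hz i hi]
    rw [huv, hρv, hv, map_sum]
    exact Finset.sum_congr rfl fun i _ => by rw [map_smul, hΨp (hp i)]
  refine ⟨{ Ψ with
    map_zero' := map_zero Ψ
    map_mul' := fun x y => ?_
    map_star' := fun x => ?_ }, hΨu⟩
  · obtain ⟨u, c, hx, -⟩ := CStarAlgebra.exists_sum_four_unitary x
    obtain ⟨v, d, hy, -⟩ := CStarAlgebra.exists_sum_four_unitary y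
    change Ψ (x * y) = Ψ x * Ψ y
    rw [hx, hy, Finset.sum_mul_sum]
    simp only [map_sum, map_smul, hΨu, Finset.sum_mul_sum, smul_mul_assoc, mul_smul_comm,
      ← h.map_mul, ← Submonoid.coe_mul]
  · obtain ⟨u, c, hx, -⟩ := CStarAlgebra.exists_sum_four_unitary x
    change Ψ (star x) = star (Ψ x)
    rw [hx]
    simp only [star_sum, star_smul, map_sum, map_smul, hΨu, ← h.rep.map_inv, ← Unitary.coe_star,
      Unitary.star_eq_inv]

end IsNearRep

theorem EpsStarHom.norm_sum_four_sub_le {A B : Type*} [NonUnitalCStarAlgebra A]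
    [NonUnitalCStarAlgebra B] {ε : ℝ} {φ : A → B} (h : EpsStarHom ε φ) {y : Fin 4 → A}
    {c : Fin 4 → ℂ} (hy : ∀ i, ‖y i‖ ≤ 1) (hc : ∀ i, ‖c i‖ ≤ 1 / 2) :
    ‖φ (∑ i, c i • y i) - ∑ i, c i • φ (y i)‖ ≤ 4 * ε := by
  have hc1 : ∀ i, ‖c i‖ ≤ 1 := fun i => (hc i).trans (by norm_num)
  have hcy : ∀ i, ‖c i • y i‖ ≤ 1 / 2 := fun i => by
    rw [norm_smul]
    nlinarith [hc i, hy i, norm_nonneg (c i), norm_nonneg (y i)]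
  have pair : ∀ i j, ‖c i • y i + c j • y j‖ ≤ 1 := fun i j =>
    (norm_add_le _ _).trans (by linarith [hcy i, hcy j])
  have h1 := h.2.1 _ _ (hy 0) (hy 1) _ _ (hc1 0) (hc1 1)
  have h2 := h.2.1 _ _ (hy 2) (hy 3) _ _ (hc1 2) (hc1 3)
  have h3 := h.2.1 _ _ (pair 0 1) (pair 2 3) 1 1 (by simp) (by simp)
  simp only [one_smul] at h3
  have e : φ (∑ i, c i • y i) - ∑ i, c i • φ (y i) =
      (φ (c 0 • y 0 + c 1 • y 1 + (c 2 • y 2 + c 3 • y 3)) -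
        (φ (c 0 • y 0 + c 1 • y 1) + φ (c 2 • y 2 + c 3 • y 3))) +
      (φ (c 0 • y 0 + c 1 • y 1) - (c 0 • φ (y 0) + c 1 • φ (y 1))) +
      (φ (c 2 • y 2 + c 3 • y 3) - (c 2 • φ (y 2) + c 3 • φ (y 3))) := by
    simp only [Fin.sum_univ_four, add_assoc]
    abel
  rw [e]
  refine norm_add₃_le.trans ?_
  have := (norm_nonneg _).trans_lt h1
  linarith

theorem IsNearRep.norm_sub_le_of_norm_le_one [FiniteDimensional ℂ A] {q : B} {ρ : unitary A → B}
    {ε δ : ℝ} {φ : A → B} (h : IsNearRep q ρ ε δ φ) {ψ : A →⋆ₙₐ[ℂ] B}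
    (hψ : ∀ u : unitary A, ψ u = ρ u) {x : A} (hx : ‖x‖ ≤ 1) :
    ‖φ x - ψ x‖ ≤ 4 * ε + 2 * δ := by
  obtain ⟨u, c, e, hc⟩ := CStarAlgebra.exists_sum_four_unitary x
  have hc' : ∀ i, ‖c i‖ ≤ 1 / 2 := fun i => (hc i).trans (by linarith)
  have hu : ∀ i, ‖(u i : A)‖ ≤ 1 := fun i => norm_coe_unitary_le_one _
  have h1 := h.hom.norm_sum_four_sub_le hu hc'
  have e2 : ψ x = ∑ i, c i • ρ (u i) := by
    conv_lhs => rw [e]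
    simp only [map_sum, map_smul, hψ]
  have h2 : ‖∑ i, c i • φ (u i) - ∑ i, c i • ρ (u i)‖ ≤ 2 * δ := by
    rw [← Finset.sum_sub_distrib]
    refine (norm_sum_le_of_le _ (f := fun i => c i • φ (u i) - c i • ρ (u i))
      (n := fun _ => 1 / 2 * δ) fun i _ => ?_).trans (by simp; linarith)
    rw [← smul_sub, norm_smul, norm_sub_rev]
    exact mul_le_mul (hc' i) (h.near _) (norm_nonneg _) (by norm_num)
  rw [← e] at h1
  rw [e2, ← sub_add_sub_cancel _ (∑ i, c i • φ (u i))]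
  exact (norm_add_le _ _).trans (by linarith)

end Generator

section Projection

theorem IsSelfAdjoint.exists_isStarProjection_near {B : Type*} [NonUnitalCStarAlgebra B] {h : B}
    (hh : IsSelfAdjoint h) {η : ℝ} (hη : η < 1 / 4) (hle : ‖h * h - h‖ ≤ η) :
    ∃ q : B, IsStarProjection q ∧ ‖q - h‖ ≤ 2 * η := by
  have hspec : ∀ x ∈ quasispectrum ℝ h, |x * x - x| ≤ η := fun x hx => by
    have h1 := norm_apply_le_norm_cfcₙ (fun x : ℝ => x * x - x) h hx
    rw [cfcₙ_sub (fun x : ℝ => x * x) (fun x => x) h, cfcₙ_mul (fun x : ℝ => x) (fun x => x) h,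
      cfcₙ_id' ℝ h] at h1
    exact h1.trans hle
  let f : ℝ → ℝ := fun x => if x < 1 / 2 then 0 else 1
  have hf0 : f 0 = 0 := by simp [f]
  have hf : ContinuousOn f (quasispectrum ℝ h) := fun x hx => by
    have h1 := abs_le.1 (hspec x hx)
    rcases lt_trichotomy x (1 / 2) with h2 | h2 | h2
    · refine (continuousAt_const (y := (0 : ℝ))).congr ?_ |>.continuousWithinAt
      filter_upwards [Iio_mem_nhds h2] with y hy
      exact (if_pos hy).symm
    · subst h2
      norm_num at h1
      linarith
    · refine (continuousAt_const (y := (1 : ℝ))).congr ?_ |>.continuousWithinAt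
      filter_upwards [Ioi_mem_nhds h2] with y hy
      exact (if_neg (not_lt.2 (le_of_lt hy))).symm
  refine ⟨cfcₙ f h, ⟨?_, cfcₙ_predicate f h⟩, ?_⟩
  · rw [IsIdempotentElem, ← cfcₙ_mul f f h]
    congr 1; ext x; simp only [f]; split_ifs <;> simp
  · have e : cfcₙ f h - h = cfcₙ (fun x => f x - x) h := by
      rw [cfcₙ_sub f (fun x => x) h, cfcₙ_id' ℝ h]
    rw [e]
    refine norm_cfcₙ_le fun x hx => ?_
    have h1 := abs_le.1 (hspec x hx)
    rw [Real.norm_eq_abs, abs_le]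
    simp only [f]
    split_ifs with h2
    · rcases le_total 0 x with h3 | h3 <;> constructor <;> nlinarith
    · rcases le_total 1 x with h3 | h3 <;> constructor <;> nlinarith

end Projection

instance compactSpace_unitary {A : Type*} [CStarAlgebra A] [FiniteDimensional ℂ A] :
    CompactSpace (unitary A) := by
  have := FiniteDimensional.proper ℂ A
  refine isCompact_iff_compactSpace.1 (Metric.isCompact_of_isClosed_isBounded ?_ ?_)
  · exact isClosed_unitary
  · exact isBounded_iff_forall_norm_le.2 ⟨1, fun u hu => norm_coe_unitary_le_one ⟨u, hu⟩⟩

instance secondCountableTopology_unitary {A : Type*} [CStarAlgebra A] [FiniteDimensional ℂ A] :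
    SecondCountableTopology (unitary A) := by
  have := FiniteDimensional.proper ℂ A
  infer_instance

namespace EpsStarHom

section NonUnital

variable {A B : Type*} [NonUnitalCStarAlgebra A] [NonUnitalCStarAlgebra B] {ε : ℝ} {φ : A → B}

theorem norm_map_le_of_norm_le (h : EpsStarHom ε φ) (hε : 0 < ε) (hε1 : ε ≤ 1) {x : A}
    (hx : ‖x‖ ≤ ε) : ‖φ x‖ ≤ 2 * ε := by
  have h0 : ‖((ε⁻¹ : ℝ) : ℂ) • x‖ ≤ 1 := by
    rw [norm_smul, Complex.norm_real, Real.norm_of_nonneg (inv_nonneg.2 hε.le),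
      inv_mul_le_iff₀ hε, mul_one]
    exact hx
  have h1 := h.2.1 (((ε⁻¹ : ℝ) : ℂ) • x) 0 h0 (by simp) (ε : ℂ) 0
    (by rw [Complex.norm_real, Real.norm_of_nonneg hε.le]; exact hε1) (by simp)
  have h2 := h.1 _ h0
  rw [smul_smul, ← Complex.ofReal_mul, mul_inv_cancel₀ hε.ne', Complex.ofReal_one, one_smul,
    smul_zero, zero_smul, add_zero, add_zero] at h1
  have h3 : ‖(ε : ℂ) • φ (((ε⁻¹ : ℝ) : ℂ) • x)‖ ≤ ε := by
    rw [norm_smul, Complex.norm_real, Real.norm_of_nonneg hε.le]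
    exact mul_le_of_le_one_right hε.le h2
  have := norm_le_norm_add_norm_sub' (φ x) ((ε : ℂ) • φ (((ε⁻¹ : ℝ) : ℂ) • x))
  linarith

theorem norm_map_sub_map_le (h : EpsStarHom ε φ) (hε : 0 < ε) (hε1 : ε ≤ 1) {x y : A}
    (hx : ‖x‖ ≤ 1) (hy : ‖y‖ ≤ 1) (hxy : ‖x - y‖ ≤ ε) : ‖φ x - φ y‖ ≤ 3 * ε := by
  have h1 := h.norm_sub_lt hx hy
  have h2 := h.norm_map_le_of_norm_le hε hε1 hxy
  have := norm_le_norm_add_norm_sub' (φ x - φ y) (φ (x - y))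
  rw [norm_sub_rev _ (φ (x - y))] at this
  linarith

end NonUnital

variable {A B : Type*} [CStarAlgebra A] [NonUnitalCStarAlgebra B] {ε : ℝ} {φ : A → B}

/-- An approximate `*`-homomorphism is close, on unitaries, to a continuous map which is compatible
with the involution. -/
theorem exists_continuous_near (h : EpsStarHom ε φ) (hε : 0 < ε) (hε1 : ε ≤ 1) :
    ∃ s : unitary A → B, Continuous s ∧ (∀ u, s u⁻¹ = star (s u)) ∧
      ∀ u : unitary A, ‖s u - φ u‖ ≤ 4 * ε := by
  obtain ⟨g, hg⟩ := exists_continuous_forall_mem_convex_of_local_const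
    (t := fun u : unitary A => Metric.closedBall (φ u) (3 * ε))
    (fun u => convex_closedBall _ _) (fun u => ⟨φ u, by
      filter_upwards [Metric.closedBall_mem_nhds u hε] with v hv
      rw [Metric.mem_closedBall, dist_eq_norm]
      refine h.norm_map_sub_map_le hε hε1 (norm_coe_unitary_le_one _) (norm_coe_unitary_le_one _) ?_
      rw [← dist_eq_norm, dist_comm]
      exact hv⟩)
  simp only [Metric.mem_closedBall, dist_eq_norm] at hg
  refine ⟨fun u => (1 / 2 : ℝ) • (g u + star (g u⁻¹)), by fun_prop, fun u => ?_, fun u => ?_⟩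
  · simp [add_comm]
  · have h1 := hg u
    have h2 := hg u⁻¹
    have h3 := h.2.2.1 u (norm_coe_unitary_le_one u)
    rw [← norm_star, star_sub] at h2
    rw [← norm_star, star_sub, star_star] at h3
    rw [← Unitary.star_eq_inv, Unitary.coe_star] at h2
    have e : (1 / 2 : ℝ) • (g u + star (g u⁻¹)) - φ u = (1 / 2 : ℝ) • ((g u - φ u) +
        (star (g (star u)) - star (φ (star (u : A)))) + (star (φ (star (u : A))) - φ u)) := by
      rw [← Unitary.star_eq_inv]
      module
    rw [e, norm_smul, Real.norm_of_nonneg (by norm_num)]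
    have := norm_add₃_le (a := g u - φ u) (b := star (g (star u)) - star (φ (star (u : A))))
      (c := star (φ (star (u : A))) - φ u)
    linarith

theorem exists_isApproxRep (h : EpsStarHom ε φ) (hε : 0 < ε) (hε1 : ε ≤ 1 / 1000) :
    ∃ (q : B) (f : unitary A → B), IsApproxRep q (500 * ε) f ∧
      ∀ u : unitary A, ‖f u - φ u‖ ≤ 116 * ε := by
  obtain ⟨s, hsc, hsinv, hs⟩ := h.exists_continuous_near hε (hε1.trans (by norm_num))
  have n1 : ‖(1 : A)‖ ≤ 1 := (IsStarProjection.one A).norm_le_one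
  have hφ : ∀ u : unitary A, ‖φ u‖ ≤ 1 := fun u => h.1 u (norm_coe_unitary_le_one u)
  set a := s 1 with ha
  set e := φ 1 with he
  have hae : ‖a - e‖ ≤ 4 * ε := by simpa using hs 1
  have hen : ‖e‖ ≤ 1 := h.1 1 n1
  have hasa : IsSelfAdjoint a := by
    have := hsinv 1
    rw [inv_one] at this
    exact this.symm
  have han : ‖a‖ ≤ 2 := by
    have := norm_le_norm_add_norm_sub' a e
    linarith
  have haa : ‖a * a - a‖ ≤ 17 * ε := by
    have h1 := h.2.2.2 1 1 n1 n1
    rw [mul_one, ← he] at h1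
    have e1 : a * a - a = ((a - e) * a + e * (a - e)) - ((e - e * e) + (a - e)) := by
      rw [sub_mul, mul_sub]; abel
    have b1 := norm_sub_le ((a - e) * a + e * (a - e)) ((e - e * e) + (a - e))
    have b2 := norm_add_le ((a - e) * a) (e * (a - e))
    have b3 := norm_add_le (e - e * e) (a - e)
    have b4 := norm_mul_le (a - e) a
    have b5 := norm_mul_le e (a - e)
    have b6 : ‖a - e‖ * ‖a‖ ≤ 4 * ε * 2 := by gcongr
    have b7 : ‖e‖ * ‖a - e‖ ≤ 1 * (4 * ε) := by gcongr
    rw [e1]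
    linarith
  obtain ⟨q, hq, hqa⟩ := hasa.exists_isStarProjection_near (by linarith) haa
  have hqn := hq.norm_le_one
  have hqq : q * q = q := hq.isIdempotentElem.eq
  have hqs : star q = q := hq.isSelfAdjoint.star_eq
  have hqe : ‖q - e‖ ≤ 38 * ε := by
    have := norm_add_le (q - a) (a - e)
    rw [sub_add_sub_cancel] at this
    linarith
  have cut_left : ∀ x : B, ‖q * x‖ ≤ ‖x‖ := fun x =>
    (norm_mul_le _ _).trans (mul_le_of_le_one_left (norm_nonneg _) hqn)
  have cut_right : ∀ x : B, ‖x * q‖ ≤ ‖x‖ := fun x =>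
    (norm_mul_le _ _).trans (mul_le_of_le_one_right (norm_nonneg _) hqn)
  have hleft : ∀ u : unitary A, ‖q * φ u - φ u‖ ≤ 39 * ε := fun u => by
    have h1 := h.2.2.2 1 u n1 (norm_coe_unitary_le_one u)
    rw [one_mul] at h1
    have e1 : q * φ u - φ u = (q - e) * φ u - (φ u - e * φ u) := by rw [sub_mul]; abel
    have b1 := norm_sub_le ((q - e) * φ u) (φ u - e * φ u)
    have b2 := norm_mul_le (q - e) (φ u)
    have b3 : ‖q - e‖ * ‖φ u‖ ≤ 38 * ε * 1 := by gcongr; exact hφ u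
    rw [e1]
    linarith
  have hright : ∀ u : unitary A, ‖φ u * q - φ u‖ ≤ 39 * ε := fun u => by
    have h1 := h.2.2.2 u 1 (norm_coe_unitary_le_one u) n1
    rw [mul_one] at h1
    have e1 : φ u * q - φ u = φ u * (q - e) - (φ u - φ u * e) := by rw [mul_sub]; abel
    have b1 := norm_sub_le (φ u * (q - e)) (φ u - φ u * e)
    have b2 := norm_mul_le (φ u) (q - e)
    have b3 : ‖φ u‖ * ‖q - e‖ ≤ 1 * (38 * ε) := by gcongr; exact hφ u
    rw [e1]
    linarith
  let f : unitary A → B := fun u => q * s u * q + q * (q - a) * q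
  have hf : ∀ u, f u = q * s u * q + q * (q - a) * q := fun _ => rfl
  have hnear : ∀ u : unitary A, ‖f u - φ u‖ ≤ 116 * ε := fun u => by
    have e1 : f u - φ u = q * (s u - φ u) * q + q * (q - a) * q + (q * φ u - φ u) * q +
        (φ u * q - φ u) := by
      rw [hf]; simp only [mul_sub, sub_mul]; abel
    have b1 := norm_add_le (q * (s u - φ u) * q + q * (q - a) * q + (q * φ u - φ u) * q)
      (φ u * q - φ u)
    have b2 := norm_add₃_le (a := q * (s u - φ u) * q) (b := q * (q - a) * q)
      (c := (q * φ u - φ u) * q)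
    have b3 := (cut_right (q * (s u - φ u))).trans (cut_left _)
    have b4 := (cut_right (q * (q - a))).trans (cut_left _)
    have b5 := cut_right (q * φ u - φ u)
    rw [e1]
    linarith [hs u, hleft u, hright u]
  refine ⟨q, f, ⟨by fun_prop, ?_, fun u => ?_, fun u => ?_, fun u v => ?_⟩, hnear⟩
  · simp only [hf, ← ha, mul_sub, sub_mul, hqq]; abel
  · simp only [hf, mul_add, ← mul_assoc, hqq]
  · simp only [hf, star_add, star_mul, star_sub, hqs, hasa.star_eq, hsinv, mul_assoc]
  · have h1 := h.2.2.2 u v (norm_coe_unitary_le_one u) (norm_coe_unitary_le_one v)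
    have hfu : ‖f u‖ ≤ 2 := by
      have := norm_le_norm_add_norm_sub' (f u) (φ u)
      linarith [hnear u, hφ u]
    have e1 : f (u * v) - f u * f v = (f (u * v) - φ (u * v : unitary A)) +
        (φ (u * v) - φ u * φ v) - ((f u - φ u) * φ v + f u * (f v - φ v)) := by
      rw [Submonoid.coe_mul]; simp only [mul_sub, sub_mul]; abel
    have b1 := norm_sub_le ((f (u * v) - φ (u * v : unitary A)) +
        (φ (u * v) - φ u * φ v)) ((f u - φ u) * φ v + f u * (f v - φ v))
    have b2 := norm_add_le (f (u * v) - φ (u * v : unitary A)) (φ (u * v) - φ u * φ v)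
    have b3 := norm_add_le ((f u - φ u) * φ v) (f u * (f v - φ v))
    have b4 := norm_mul_le (f u - φ u) (φ v)
    have b5 := norm_mul_le (f u) (f v - φ v)
    have b6 : ‖f u - φ u‖ * ‖φ v‖ ≤ 116 * ε * 1 := by gcongr; exacts [hnear u, hφ v]
    have b7 : ‖f u‖ * ‖f v - φ v‖ ≤ 2 * (116 * ε) := by gcongr; exact hnear v
    rw [e1]
    linarith [hnear (u * v)]

theorem exists_isNearRep [FiniteDimensional ℂ A] (h : EpsStarHom ε φ) (hε : 0 < ε)
    (hε1 : ε ≤ 1 / 1000000) :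
    ∃ (q : B) (ρ : unitary A → B), IsNearRep q ρ ε (2200 * ε) φ := by
  obtain ⟨q, f, hf, hnear⟩ := h.exists_isApproxRep hε (hε1.trans (by norm_num))
  obtain ⟨ρ, hρ, hρf⟩ := hf.exists_rep (by linarith) fun u => by
    have := norm_le_norm_add_norm_sub' (f u) (φ u)
    linarith [hnear u, h.1 u (norm_coe_unitary_le_one u)]
  refine ⟨q, ρ, hρ, h, fun u => ?_, by linarith, by linarith⟩
  have := norm_add_le (ρ u - f u) (f u - φ u)
  rw [sub_add_sub_cancel] at this
  linarith [hnear u, hρf u]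

theorem exists_starHom_near_of_unital [FiniteDimensional ℂ A] (h : EpsStarHom ε φ) (hε : 0 < ε)
    (hε1 : ε ≤ 1 / 1000000) :
    ∃ ψ : A →⋆ₙₐ[ℂ] B, ∀ x : A, ‖x‖ ≤ 1 → ‖φ x - ψ x‖ ≤ 5000 * ε := by
  obtain ⟨q, ρ, hρ⟩ := h.exists_isNearRep hε hε1
  obtain ⟨ψ, hψ⟩ := hρ.exists_starHom
  exact ⟨ψ, fun x hx => (hρ.norm_sub_le_of_norm_le_one hψ hx).trans (by linarith)⟩

end EpsStarHom

section Unit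

theorem NonUnitalCStarAlgebra.exists_unit_of_finiteDimensional (A : Type*)
    [NonUnitalCStarAlgebra A] [FiniteDimensional ℂ A] : ∃ e : A, ∀ x, e * x = x ∧ x * e = x := by
  have := FiniteDimensional.proper ℂ A
  let _ := CStarAlgebra.spectralOrder A
  have := CStarAlgebra.spectralOrderedRing A
  have hl := CStarAlgebra.increasingApproximateUnit A
  have := hl.neBot
  obtain ⟨e, -, he⟩ := (isCompact_closedBall (0 : A) 1).exists_clusterPt
    (f := CStarAlgebra.approximateUnit A) (le_principal_iff.2 (by
      filter_upwards [hl.eventually_norm] with x hx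
      simpa using hx))
  have : NeBot (𝓝 e ⊓ CStarAlgebra.approximateUnit A) := he
  refine ⟨e, fun x => ⟨?_, ?_⟩⟩
  · exact tendsto_nhds_unique (((continuous_id.mul continuous_const).tendsto e).mono_left inf_le_left)
      ((hl.tendsto_mul_right x).mono_left inf_le_right)
  · exact tendsto_nhds_unique (((continuous_const.mul continuous_id).tendsto e).mono_left inf_le_left)
      ((hl.tendsto_mul_left x).mono_left inf_le_right)

/-- A C*-algebra with a two-sided unit, as a unital C*-algebra. -/
abbrev NonUnitalCStarAlgebra.toCStarAlgebraOfUnit {A : Type*} [inst : NonUnitalCStarAlgebra A]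
    (e : A) (he : ∀ x, e * x = x ∧ x * e = x) : CStarAlgebra A :=
  let _ : NormedRing A :=
    { inst with
      one := e
      one_mul := fun x => (he x).1
      mul_one := fun x => (he x).2 }
  let _ : Algebra ℂ A := Algebra.ofModule smul_mul_assoc mul_smul_comm
  { inst with
    one_mul := fun x => (he x).1
    mul_one := fun x => (he x).2
    algebraMap := algebraMap ℂ A
    commutes' := Algebra.commutes
    smul_def' := Algebra.smul_def
    norm_smul_le := norm_smul_le }

end Unit

namespace EpsStarHom

variable {A B : Type*} [NonUnitalCStarAlgebra A] [NonUnitalCStarAlgebra B] [FiniteDimensional ℂ A]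
  {ε : ℝ} {φ : A → B}

theorem exists_starHom_near (h : EpsStarHom ε φ) (hε : 0 < ε) (hε1 : ε ≤ 1 / 1000000) :
    ∃ ψ : A →⋆ₙₐ[ℂ] B, ∀ x : A, ‖x‖ ≤ 1 → ‖φ x - ψ x‖ ≤ 5000 * ε := by
  obtain ⟨e, he⟩ := NonUnitalCStarAlgebra.exists_unit_of_finiteDimensional A
  let inst := NonUnitalCStarAlgebra.toCStarAlgebraOfUnit e he
  exact exists_starHom_near_of_unital (A := A) h hε hε1

end EpsStarHom

section Bijective

variable {A B : Type*} [NonUnitalCStarAlgebra A] [NonUnitalCStarAlgebra B] {ε δ : ℝ} {φ : A → B}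
  {ψ : A →⋆ₙₐ[ℂ] B}

theorem EpsIsometric.injective_of_near (h : EpsIsometric ε φ) (hεδ : ε + δ ≤ 1 / 2)
    (hψ : ∀ x : A, ‖x‖ ≤ 1 → ‖φ x - ψ x‖ ≤ δ) : Function.Injective ψ := by
  rw [injective_iff_map_eq_zero]
  intro x hx
  by_contra h0
  let y : A := ((‖x‖⁻¹ : ℝ) : ℂ) • x
  have hy : ‖y‖ = 1 := by
    rw [norm_smul, Complex.norm_real, norm_inv, norm_norm, inv_mul_cancel₀ (norm_ne_zero_iff.2 h0)]
  have h1 := abs_lt.1 (h y hy.le)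
  have h2 := hψ y hy.le
  rw [map_smul, hx, smul_zero, sub_zero] at h2
  linarith [h1.2]

theorem EpsSurjective.surjective_of_near [FiniteDimensional ℂ A] (h : EpsSurjective ε φ)
    (hεδ : ε + δ ≤ 1 / 2) (hψ : ∀ x : A, ‖x‖ ≤ 1 → ‖φ x - ψ x‖ ≤ δ) : Function.Surjective ψ := by
  let T : A →ₗ[ℂ] B := (ψ : A →ₗ[ℂ] B)
  by_contra hsurj
  simp only [Function.Surjective, not_forall] at hsurj
  obtain ⟨b, hb⟩ := hsurj
  obtain ⟨x₀, hx₀, hdist⟩ := riesz_lemma (F := LinearMap.range T)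
    (Submodule.closed_of_finiteDimensional _) ⟨b, fun ⟨a, ha⟩ => hb ⟨a, ha⟩⟩
    (r := 1 / 2) (by norm_num)
  have h0 : x₀ ≠ 0 := fun e => hx₀ (e ▸ zero_mem _)
  have hpos := norm_pos_iff.2 h0
  obtain ⟨x, hx, hbx⟩ := h (((‖x₀‖⁻¹ : ℝ) : ℂ) • x₀) (by
    rw [norm_smul, Complex.norm_real, norm_inv, norm_norm, inv_mul_cancel₀ hpos.ne'])
  have h1 := hdist (T ((‖x₀‖ : ℂ) • x)) ⟨_, rfl⟩
  have h2 : x₀ - T ((‖x₀‖ : ℂ) • x) =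
      (‖x₀‖ : ℂ) • (((‖x₀‖⁻¹ : ℝ) : ℂ) • x₀ - φ x + (φ x - ψ x)) := by
    rw [sub_add_sub_cancel, smul_sub, smul_smul, ← Complex.ofReal_mul, mul_inv_cancel₀ hpos.ne',
      Complex.ofReal_one, one_smul, map_smul]
    rfl
  have h3 := norm_add_le (((‖x₀‖⁻¹ : ℝ) : ℂ) • x₀ - φ x) (φ x - ψ x)
  rw [h2, norm_smul, Complex.norm_real, norm_norm] at h1
  nlinarith [hψ x hx]

end Bijective

end Stability

/-- **(Stability of `ε`-`*`-homomorphisms on finite-dimensional C*-algebras.)**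
There is a constant `K > 0` such that for every `0 < ε < 1/4`, every finite-dimensional
C*-algebra `A`, every C*-algebra `B` and every `ε`-`*`-homomorphism `φ : A → B`, there is a
genuine `*`-homomorphism `ψ : A → B` with `‖φ x - ψ x‖ < K·√ε` on the unit ball.  Moreover
there is `ε₀ > 0` such that if in addition `ε < ε₀` and `φ` is an `ε`-isomorphism, then `ψ`
may be chosen to be a `*`-isomorphism of `A` onto `B`. -/
theorem exists_starHom_near_epsStarHom_finiteDimensional :
    ∃ K : ℝ, 0 < K ∧ ∃ ε₀ : ℝ, 0 < ε₀ ∧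
      ∀ (A B : Type) [NonUnitalCStarAlgebra A] [NonUnitalCStarAlgebra B]
        [FiniteDimensional ℂ A] (ε : ℝ), 0 < ε → ε < 1 / 4 →
        ∀ φ : A → B, EpsStarHom ε φ →
          (∃ ψ : A →⋆ₙₐ[ℂ] B, ∀ x : A, ‖x‖ ≤ 1 → ‖φ x - ψ x‖ < K * Real.sqrt ε) ∧
          (ε < ε₀ → EpsIsomorphism ε φ →
            ∃ ψ : A →⋆ₙₐ[ℂ] B, Function.Bijective ψ ∧
              ∀ x : A, ‖x‖ ≤ 1 → ‖φ x - ψ x‖ < K * Real.sqrt ε) := by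
  refine ⟨6000, by norm_num, 1 / 1000000, by norm_num, ?_⟩
  intro A B _ _ _ ε hε hε4 φ h
  have hsqrt : ε ≤ Real.sqrt ε := Real.le_sqrt_of_sq_le (by nlinarith)
  have hlt : 5000 * ε < 6000 * Real.sqrt ε := by linarith
  constructor
  · rcases le_total ε (1 / 1000000) with hsmall | hlarge
    · obtain ⟨ψ, hψ⟩ := h.exists_starHom_near hε hsmall
      exact ⟨ψ, fun x hx => (hψ x hx).trans_lt hlt⟩
    · refine ⟨0, fun x hx => ?_⟩
      have h1 : 1 / 1000 ≤ Real.sqrt ε := Real.le_sqrt_of_sq_le (by norm_num; linarith)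
      simp only [NonUnitalStarAlgHom.zero_apply, sub_zero]
      linarith [h.1 x hx]
  · intro hsmall hiso
    obtain ⟨ψ, hψ⟩ := h.exists_starHom_near hε hsmall.le
    exact ⟨ψ, ⟨hiso.1.2.injective_of_near (by linarith) hψ,
      hiso.2.surjective_of_near (by linarith) hψ⟩, fun x hx => (hψ x hx).trans_lt hlt⟩
end
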